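/- arXiv:2510.04875 — 2 statements merged into one kernel-verified Lean document; each statement's English description precedes it below -/
import Mathlib

section
/- Let V be the Vicsek set and let T̃(x₁,x₂) = (3x₁ mod 1, 3x₂ mod 1). Let ξ ≥ λ > 0 be real numbers and fix y = (y₁,y₂) ∈ V. Suppose that for each a ∈ {0,1,2} the base-3 digit frequency of y₂ exists, i.e. writing y₂ = Σ_{i≥1} w_i 3^{−i} with digits w_i ∈ {0,1,2}, the limit lim_{n→∞} #{1 ≤ i ≤ n : w_i = a}/n exists for every a. Define V_{λ,ξ}(y) = {x ∈ V : T̃ⁿ(x) ∈ [y₁−3^{−nλ}, y₁+3^{−nλ}] × [y₂−3^{−nξ}, y₂+3^{−nξ}] for infinitely many n ∈ ℕ}. Then dim_H V_{λ,ξ}(y) = min{ dim_H V/(1+λ), (dim_H V + (ξ−λ)·dim_H V_y)/(1+ξ) }, where V_y = {x ∈ [0,1] : (x,y₂) ∈ V} is the horizontal slice through V at y. -/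
open Set Filter Topology MeasureTheory
open scoped ENNReal Topology

noncomputable section

namespace Vicsek

/-- The digit set of the Vicsek set. -/
def vDigits : Finset (ℕ × ℕ) := {(0, 0), (2, 0), (0, 2), (1, 1), (2, 2)}

/-- The base-3 value of a 1-indexed digit string (digit `i` is `u i` for `i ≥ 1`). -/
def val3 (u : ℕ → ℕ) : ℝ := ∑' i : ℕ, (u (i + 1) : ℝ) / 3 ^ (i + 1)

/-- The Vicsek set (cross fractal): points of `[0,1]²` with a two-dimensional base-3
expansion using only the digit pairs `(0,0), (2,0), (0,2), (1,1), (2,2)`. -/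
def V : Set (ℝ × ℝ) :=
  {p | ∃ d : ℕ → ℕ × ℕ, (∀ i, 1 ≤ i → d i ∈ vDigits) ∧
    p = (val3 (fun i => (d i).1), val3 (fun i => (d i).2))}

/-- `T̃(x₁,x₂) = (3x₁ mod 1, 3x₂ mod 1)`. -/
def Ttilde (p : ℝ × ℝ) : ℝ × ℝ := (Int.fract (3 * p.1), Int.fract (3 * p.2))

/-- The integer whose base-3 digits are the first `n` digits `u 1, …, u n`. -/
def prefixNum (u : ℕ → ℕ) : ℕ → ℕ
  | 0 => 0
  | n + 1 => 3 * prefixNum u n + u (n + 1)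

/-- The number of indices in `[1, n]` at which the digit of `u` is not `1`. -/
def nonOnes (u : ℕ → ℕ) (n : ℕ) : ℕ := ((Finset.Icc 1 n).filter fun i => u i ≠ 1).card

/-- The number of base-3 digits different from `1` among the lowest `k` digits of `b`. -/
def lowNonOnes : ℕ → ℕ → ℕ
  | 0, _ => 0
  | k + 1, b => (if b % 3 = 1 then 0 else 1) + lowNonOnes k (b / 3)

/-- The integer positions of the level-`n` squares in the construction of the Vicsek set. -/
def levelSquares : ℕ → Finset (ℕ × ℕ)
  | 0 => {(0, 0)}
  | n + 1 => (levelSquares n ×ˢ vDigits).image fun q => (3 * q.1.1 + q.2.1, 3 * q.1.2 + q.2.2)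

section Digits

variable {u v : ℕ → ℕ}

lemma hasSum_two_div_three_pow : HasSum (fun i : ℕ => (2 : ℝ) / 3 ^ (i + 1)) 1 := by
  have h := (hasSum_geometric_of_lt_one (r := (1 / 3 : ℝ)) (by norm_num) (by norm_num)).mul_left
    (2 / 3 : ℝ)
  rw [show (2 / 3 : ℝ) * (1 - 1 / 3)⁻¹ = 1 by norm_num] at h
  have e : (fun i : ℕ => (2 : ℝ) / 3 ^ (i + 1)) = fun i => 2 / 3 * (1 / 3) ^ i := by
    ext i
    rw [pow_succ, one_div, inv_pow]
    field_simp
  rwa [e]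

lemma digit_div_le (hu : ∀ i, 1 ≤ i → u i < 3) (i : ℕ) :
    (u (i + 1) : ℝ) / 3 ^ (i + 1) ≤ 2 / 3 ^ (i + 1) := by
  have : (u (i + 1) : ℝ) ≤ 2 := by exact_mod_cast Nat.lt_succ_iff.1 (hu (i + 1) (by omega))
  gcongr

lemma summable_val3 (hu : ∀ i, 1 ≤ i → u i < 3) :
    Summable fun i : ℕ => (u (i + 1) : ℝ) / 3 ^ (i + 1) :=
  Summable.of_nonneg_of_le (fun _ => by positivity) (digit_div_le hu)
    hasSum_two_div_three_pow.summable

lemma val3_nonneg (u : ℕ → ℕ) : 0 ≤ val3 u := tsum_nonneg fun _ => by positivity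

lemma val3_le_one (hu : ∀ i, 1 ≤ i → u i < 3) : val3 u ≤ 1 :=
  hasSum_two_div_three_pow.tsum_eq ▸
    (summable_val3 hu).tsum_le_tsum (digit_div_le hu) hasSum_two_div_three_pow.summable

lemma val3_lt_one (hu : ∀ i, 1 ≤ i → u i < 3) {j : ℕ} (hj : 1 ≤ j) (huj : u j < 2) :
    val3 u < 1 := by
  rw [← hasSum_two_div_three_pow.tsum_eq]
  refine Summable.tsum_lt_tsum (i := j - 1) (digit_div_le hu) ?_ (summable_val3 hu)
    hasSum_two_div_three_pow.summable
  rw [Nat.sub_add_cancel hj]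
  have : (u j : ℝ) < 2 := by exact_mod_cast huj
  gcongr

lemma three_mul_val3 (hu : ∀ i, 1 ≤ i → u i < 3) :
    3 * val3 u = u 1 + val3 fun i => u (i + 1) := by
  unfold val3
  rw [(summable_val3 hu).tsum_eq_zero_add, mul_add, ← tsum_mul_left]
  congr 1
  · simp; ring
  · refine tsum_congr fun i => ?_
    rw [pow_succ 3 (i + 1)]
    field_simp

lemma pow_mul_val3 (hu : ∀ i, 1 ≤ i → u i < 3) (n : ℕ) :
    3 ^ n * val3 u = prefixNum u n + val3 fun i => u (i + n) := by
  induction n with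
  | zero => simp [prefixNum]
  | succ n ih =>
    have h := three_mul_val3 (u := fun i => u (i + n)) fun i hi => hu _ (by omega)
    rw [pow_succ, mul_right_comm, ih, add_mul, mul_comm (val3 _), h]
    simp only [prefixNum]
    push_cast
    rw [add_comm 1 n]
    simp only [add_assoc, add_comm 1 n]
    ring

lemma prefixNum_le_pow_mul_val3 (hu : ∀ i, 1 ≤ i → u i < 3) (n : ℕ) :
    (prefixNum u n : ℝ) ≤ 3 ^ n * val3 u := by
  rw [pow_mul_val3 hu]
  linarith [val3_nonneg fun i => u (i + n)]

lemma pow_mul_val3_le_prefixNum_add_one (hu : ∀ i, 1 ≤ i → u i < 3) (n : ℕ) :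
    3 ^ n * val3 u ≤ prefixNum u n + 1 := by
  rw [pow_mul_val3 hu]
  linarith [val3_le_one (u := fun i => u (i + n)) fun i hi => hu _ (by omega)]

lemma prefixNum_le_add_two (hu : ∀ i, 1 ≤ i → u i < 3) (hv : ∀ i, 1 ≤ i → v i < 3) {n : ℕ}
    (h : |val3 u - val3 v| ≤ 1 / 3 ^ n) : prefixNum u n ≤ prefixNum v n + 2 := by
  have h1 := prefixNum_le_pow_mul_val3 hu n
  have h2 := pow_mul_val3_le_prefixNum_add_one hv n
  have h3 := (abs_le.1 h).2
  have h4 : (3 : ℝ) ^ n * (val3 u - val3 v) ≤ 1 := by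
    calc (3 : ℝ) ^ n * (val3 u - val3 v) ≤ 3 ^ n * (1 / 3 ^ n) := by gcongr
      _ = 1 := by field_simp
  have : (prefixNum u n : ℝ) ≤ prefixNum v n + 2 := by linarith
  exact_mod_cast this

lemma prefixNum_le_add_one (hu : ∀ i, 1 ≤ i → u i < 3) (hv : ∀ i, 1 ≤ i → v i < 3)
    (h : val3 u = val3 v) (n : ℕ) : prefixNum u n ≤ prefixNum v n + 1 := by
  have h1 := prefixNum_le_pow_mul_val3 hu n
  have h2 := pow_mul_val3_le_prefixNum_add_one hv n
  rw [h] at h1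
  exact_mod_cast h1.trans h2

lemma prefixNum_congr {n : ℕ} (h : ∀ i, 1 ≤ i → i ≤ n → u i = v i) :
    prefixNum u n = prefixNum v n := by
  induction n with
  | zero => rfl
  | succ n ih =>
    rw [prefixNum, prefixNum, ih fun i h1 h2 => h i h1 (by omega), h (n + 1) (by omega) le_rfl]

lemma eq_of_prefixNum_eq (hu : ∀ i, 1 ≤ i → u i < 3) (hv : ∀ i, 1 ≤ i → v i < 3) {n : ℕ}
    (h : prefixNum u n = prefixNum v n) {i : ℕ} (hi : 1 ≤ i) (hin : i ≤ n) : u i = v i := by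
  induction n with
  | zero => omega
  | succ n ih =>
    simp only [prefixNum] at h
    have h1 := hu (n + 1) (by omega)
    have h2 := hv (n + 1) (by omega)
    rcases Nat.lt_or_ge n i with h3 | h3
    · obtain rfl : i = n + 1 := by omega
      omega
    · exact ih (by omega) h3

lemma abs_val3_sub_le (hu : ∀ i, 1 ≤ i → u i < 3) (hv : ∀ i, 1 ≤ i → v i < 3) {n : ℕ}
    (h : ∀ i, 1 ≤ i → i ≤ n → u i = v i) : |val3 u - val3 v| ≤ 1 / 3 ^ n := by
  have h1 := prefixNum_le_pow_mul_val3 hu n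
  have h2 := pow_mul_val3_le_prefixNum_add_one hu n
  have h3 := prefixNum_le_pow_mul_val3 hv n
  have h4 := pow_mul_val3_le_prefixNum_add_one hv n
  rw [prefixNum_congr h] at h1 h2
  rw [le_div_iff₀ (by positivity), ← abs_of_pos (show (0 : ℝ) < 3 ^ n by positivity), ← abs_mul,
    abs_le]
  constructor <;> linarith

lemma prefixNum_add_div_pow (hu : ∀ i, 1 ≤ i → u i < 3) (m k : ℕ) :
    prefixNum u (m + k) / 3 ^ k = prefixNum u m := by
  induction k with
  | zero => simp
  | succ k ih =>
    have := hu (m + k + 1) (by omega)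
    rw [← add_assoc, prefixNum, pow_succ', ← Nat.div_div_eq_div_mul,
      show (3 * prefixNum u (m + k) + u (m + k + 1)) / 3 = prefixNum u (m + k) by omega, ih]

lemma nonOnes_succ (u : ℕ → ℕ) (n : ℕ) :
    nonOnes u (n + 1) = (if u (n + 1) = 1 then 0 else 1) + nonOnes u n := by
  unfold nonOnes
  rw [← Finset.insert_Icc_right_eq_Icc_add_one (by omega), Finset.filter_insert]
  by_cases h : u (n + 1) = 1
  · simp [h]
  · rw [if_pos h, if_neg h, Finset.card_insert_of_notMem (by simp), add_comm]

lemma nonOnes_add_lowNonOnes (hu : ∀ i, 1 ≤ i → u i < 3) (m k : ℕ) :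
    nonOnes u m + lowNonOnes k (prefixNum u (m + k)) = nonOnes u (m + k) := by
  induction k with
  | zero => simp [lowNonOnes]
  | succ k ih =>
    have := hu (m + k + 1) (by omega)
    rw [← add_assoc, nonOnes_succ, ← ih, lowNonOnes, prefixNum,
      show (3 * prefixNum u (m + k) + u (m + k + 1)) / 3 = prefixNum u (m + k) by omega,
      show (3 * prefixNum u (m + k) + u (m + k + 1)) % 3 = u (m + k + 1) by omega]
    ring

lemma lowNonOnes_succ_bounds (k b : ℕ) :
    lowNonOnes k (b + 1) ≤ lowNonOnes k b + 1 ∧ lowNonOnes k b ≤ lowNonOnes k (b + 1) + 1 := by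
  induction k generalizing b with
  | zero => simp [lowNonOnes]
  | succ k ih =>
    simp only [lowNonOnes]
    by_cases h : b % 3 = 2
    · rw [show (b + 1) / 3 = b / 3 + 1 by omega, if_neg (by omega), if_neg (by omega)]
      have := ih (b / 3)
      omega
    · rw [show (b + 1) / 3 = b / 3 by omega]
      split_ifs <;> omega

lemma lowNonOnes_le_add {b c t : ℕ} (k : ℕ) (h1 : b ≤ c + t) (h2 : c ≤ b + t) :
    lowNonOnes k b ≤ lowNonOnes k c + t := by
  induction t generalizing b with
  | zero => rw [show b = c by omega]; omega
  | succ t ih =>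
    rcases lt_trichotomy b c with h | h | h
    · have := ih (b := b + 1) (by omega) (by omega)
      have := (lowNonOnes_succ_bounds k b).2
      omega
    · rw [h]; omega
    · obtain ⟨b, rfl⟩ : ∃ b', b = b' + 1 := ⟨b - 1, by omega⟩
      have := ih (b := b) (by omega) (by omega)
      have := (lowNonOnes_succ_bounds k b).1
      omega

lemma nonOnes_le_add_one (hu : ∀ i, 1 ≤ i → u i < 3) (hv : ∀ i, 1 ≤ i → v i < 3)
    (h : val3 u = val3 v) (n : ℕ) : nonOnes u n ≤ nonOnes v n + 1 := by
  have h1 := nonOnes_add_lowNonOnes hu 0 n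
  have h2 := nonOnes_add_lowNonOnes hv 0 n
  have h3 := lowNonOnes_le_add n (prefixNum_le_add_one hu hv h n)
    (prefixNum_le_add_one hv hu h.symm n)
  simp only [zero_add] at h1 h2
  rw [← h1, ← h2]
  simp [nonOnes]
  exact h3

end Digits

lemma lt_three_of_mem_vDigits {q : ℕ × ℕ} (h : q ∈ vDigits) : q.1 < 3 ∧ q.2 < 3 := by
  simp only [vDigits, Finset.mem_insert, Finset.mem_singleton] at h
  rcases h with rfl | rfl | rfl | rfl | rfl <;> norm_num

lemma card_filter_vDigits {b : ℕ} (hb : b < 3) :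
    (vDigits.filter fun q => q.2 = b).card = 2 ^ (if b = 1 then 0 else 1) := by
  interval_cases b <;> decide

lemma card_levelSquares_le (n : ℕ) : (levelSquares n).card ≤ 5 ^ n := by
  induction n with
  | zero => simp [levelSquares]
  | succ n ih =>
    refine Finset.card_image_le.trans ?_
    rw [Finset.card_product, pow_succ]
    exact Nat.mul_le_mul ih (by decide)

lemma prefixNum_mem_levelSquares {d : ℕ → ℕ × ℕ} (hd : ∀ i, 1 ≤ i → d i ∈ vDigits) (n : ℕ) :
    (prefixNum (fun i => (d i).1) n, prefixNum (fun i => (d i).2) n) ∈ levelSquares n := by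
  induction n with
  | zero => simp [levelSquares, prefixNum]
  | succ n ih =>
    exact Finset.mem_image.2
      ⟨(_, d (n + 1)), Finset.mem_product.2 ⟨ih, hd _ (by omega)⟩, rfl⟩

lemma card_levelSquares_row_le (m k b c : ℕ) :
    ((levelSquares (m + k)).filter fun q => q.2 = b ∧ q.1 / 3 ^ k = c).card
      ≤ 2 ^ lowNonOnes k b := by
  induction k generalizing b with
  | zero =>
    refine (Finset.card_le_card (t := {(c, b)}) fun q hq => ?_).trans (by simp [lowNonOnes])
    obtain ⟨h1, h2⟩ := (Finset.mem_filter.1 hq).2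
    simp only [pow_zero, Nat.div_one] at h2
    simp [← h1, ← h2]
  | succ k ih =>
    have hsub : ((levelSquares (m + (k + 1))).filter fun q => q.2 = b ∧ q.1 / 3 ^ (k + 1) = c) ⊆
        (((levelSquares (m + k)).filter fun q => q.2 = b / 3 ∧ q.1 / 3 ^ k = c) ×ˢ
          (vDigits.filter fun q => q.2 = b % 3)).image
            fun q => (3 * q.1.1 + q.2.1, 3 * q.1.2 + q.2.2) := by
      intro q hq
      obtain ⟨h0, h1, h2⟩ := Finset.mem_filter.1 hq
      obtain ⟨⟨p, e⟩, hp, rfl⟩ := Finset.mem_image.1 h0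
      obtain ⟨hp, he⟩ := Finset.mem_product.1 hp
      obtain ⟨h3, h4⟩ := lt_three_of_mem_vDigits he
      simp only at h1 h2 h3 h4 hp he
      refine Finset.mem_image.2 ⟨(p, e), Finset.mem_product.2 ⟨Finset.mem_filter.2
        ⟨hp, by simp only; omega, ?_⟩, Finset.mem_filter.2 ⟨he, by simp only; omega⟩⟩, rfl⟩
      rw [pow_succ', ← Nat.div_div_eq_div_mul] at h2
      rw [← h2]
      congr 1
      simp only
      omega
    refine (Finset.card_le_card hsub).trans (Finset.card_image_le.trans ?_)
    rw [Finset.card_product, card_filter_vDigits (Nat.mod_lt _ (by norm_num)), mul_comm, lowNonOnes,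
      pow_add]
    exact Nat.mul_le_mul le_rfl (ih _)

lemma card_levelSquares_near_le (m k r c : ℕ) :
    ((levelSquares (m + k)).filter fun q =>
      (q.2 ≤ r + 2 ∧ r ≤ q.2 + 2) ∧ (q.1 / 3 ^ k ≤ c + 2 ∧ c ≤ q.1 / 3 ^ k + 2)).card
      ≤ 100 * 2 ^ lowNonOnes k r := by
  have hsub : ((levelSquares (m + k)).filter fun q =>
      (q.2 ≤ r + 2 ∧ r ≤ q.2 + 2) ∧ (q.1 / 3 ^ k ≤ c + 2 ∧ c ≤ q.1 / 3 ^ k + 2)) ⊆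
      (Finset.Icc (r - 2) (r + 2) ×ˢ Finset.Icc (c - 2) (c + 2)).biUnion fun t =>
        (levelSquares (m + k)).filter fun q => q.2 = t.1 ∧ q.1 / 3 ^ k = t.2 := by
    intro q hq
    obtain ⟨h0, h1, h2⟩ := Finset.mem_filter.1 hq
    refine Finset.mem_biUnion.2 ⟨(q.2, q.1 / 3 ^ k), ?_, Finset.mem_filter.2 ⟨h0, rfl, rfl⟩⟩
    simp only [Finset.mem_product, Finset.mem_Icc]
    generalize q.1 / 3 ^ k = x at *
    omega
  refine (Finset.card_le_card hsub).trans ?_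
  refine (Finset.card_biUnion_le_card_mul _ _ (4 * 2 ^ lowNonOnes k r) fun t ht => ?_).trans ?_
  · refine (card_levelSquares_row_le m k t.1 t.2).trans ?_
    simp only [Finset.mem_product, Finset.mem_Icc] at ht
    have := lowNonOnes_le_add (t := 2) k (b := t.1) (c := r) (by omega) (by omega)
    calc 2 ^ lowNonOnes k t.1 ≤ 2 ^ (lowNonOnes k r + 2) := Nat.pow_le_pow_right (by norm_num) this
      _ = _ := by rw [pow_add]; ring
  · rw [Finset.card_product, Nat.card_Icc, Nat.card_Icc, show 100 = 5 * 5 * 4 by norm_num,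
      ← mul_assoc]
    gcongr <;> omega

/-- The points of the plane having a base-3 expansion whose `i`-th digit pair lies in `D i`. -/
def digitSet (D : ℕ → Finset (ℕ × ℕ)) : Set (ℝ × ℝ) :=
  {p | ∃ d : ℕ → ℕ × ℕ, (∀ i, 1 ≤ i → d i ∈ D i) ∧
    p = (val3 (fun i => (d i).1), val3 (fun i => (d i).2))}

lemma continuous_val3_comp {X : Type*} [TopologicalSpace X] {u : X → ℕ → ℕ}
    (hu : ∀ x i, 1 ≤ i → u x i < 3) (hc : ∀ i, Continuous fun x => u x i) :
    Continuous fun x => val3 (u x) := by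
  refine continuous_tsum (fun i => ?_) hasSum_two_div_three_pow.summable fun i x => ?_
  · exact (continuous_of_discreteTopology.comp (hc (i + 1))).div_const _
  · rw [Real.norm_of_nonneg (by positivity)]
    exact digit_div_le (hu x) i

lemma prefixNum_mem_Icc_of_abs_sub_le {u : ℕ → ℕ} (hu : ∀ i, 1 ≤ i → u i < 3) {n : ℕ} {x δ : ℝ}
    (h : |val3 u - x| ≤ δ) (hδ : δ ≤ 1 / 3 ^ n) :
    prefixNum u n ∈ Finset.Icc ⌈3 ^ n * x - 2⌉₊ (⌈3 ^ n * x - 2⌉₊ + 3) := by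
  have h1 := prefixNum_le_pow_mul_val3 hu n
  have h2 := pow_mul_val3_le_prefixNum_add_one hu n
  have h3 : |(3 : ℝ) ^ n * val3 u - 3 ^ n * x| ≤ 1 := by
    rw [← mul_sub, abs_mul, abs_of_pos (by positivity)]
    calc (3 : ℝ) ^ n * |val3 u - x| ≤ 3 ^ n * (1 / 3 ^ n) := by gcongr; exact h.trans hδ
      _ = 1 := by field_simp
  obtain ⟨h4, h5⟩ := abs_le.1 h3
  rw [Finset.mem_Icc]
  refine ⟨Nat.ceil_le.2 (by linarith), ?_⟩
  have h6 := Nat.le_ceil ((3 : ℝ) ^ n * x - 2)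
  have : (prefixNum u n : ℝ) ≤ ⌈(3 : ℝ) ^ n * x - 2⌉₊ + 3 := by linarith
  exact_mod_cast this

lemma exists_measure_digitSet {D : ℕ → Finset (ℕ × ℕ)} (hne : ∀ i, (D i).Nonempty)
    (hD : ∀ i, D i ⊆ vDigits) :
    ∃ ν : Measure (ℝ × ℝ), ν (digitSet D) ≠ 0 ∧ ∀ (p : ℝ × ℝ) (n : ℕ) (δ : ℝ), δ ≤ 1 / 3 ^ n →
      ν (Metric.closedBall p δ) ≤ 16 * (∏ i ∈ Finset.Icc 1 n, ((D i).card : ℝ≥0∞))⁻¹ := by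
  have hne' : ∀ i, Nonempty (D i) := fun i => (hne i).to_subtype
  let μ : ∀ i, Measure (D i) := fun i => (PMF.uniformOfFintype (D i)).toMeasure
  let P := Measure.infinitePi μ
  let f : (∀ i, D i) → ℝ × ℝ := fun d =>
    (val3 fun i => (d i : ℕ × ℕ).1, val3 fun i => (d i : ℕ × ℕ).2)
  have hlt : ∀ (d : ∀ i, D i) i, (d i : ℕ × ℕ).1 < 3 ∧ (d i : ℕ × ℕ).2 < 3 := fun d i =>
    lt_three_of_mem_vDigits (hD i (d i).2)
  have hf : Continuous f :=
    (continuous_val3_comp (fun d i _ => (hlt d i).1) fun i =>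
      continuous_fst.comp (continuous_subtype_val.comp (continuous_apply i))).prodMk
    (continuous_val3_comp (fun d i _ => (hlt d i).2) fun i =>
      continuous_snd.comp (continuous_subtype_val.comp (continuous_apply i)))
  refine ⟨P.map f, ?_, fun p n δ hδ => ?_⟩
  · have h1 : f ⁻¹' digitSet D = univ :=
      eq_univ_of_forall fun d => ⟨fun i => d i, fun i _ => (d i).2, rfl⟩
    have h2 := Measure.le_map_apply (μ := P) hf.measurable.aemeasurable (digitSet D)
    rw [h1, measure_univ] at h2
    exact (lt_of_lt_of_le one_pos h2).ne'
  rw [Measure.map_apply hf.measurable measurableSet_closedBall]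
  set A := Finset.Icc ⌈3 ^ n * p.1 - 2⌉₊ (⌈3 ^ n * p.1 - 2⌉₊ + 3)
  set B := Finset.Icc ⌈3 ^ n * p.2 - 2⌉₊ (⌈3 ^ n * p.2 - 2⌉₊ + 3)
  let S : ℕ × ℕ → Set (∀ i, D i) := fun q => {d |
    prefixNum (fun i => (d i : ℕ × ℕ).1) n = q.1 ∧ prefixNum (fun i => (d i : ℕ × ℕ).2) n = q.2}
  have hS : ∀ q, P (S q) ≤ (∏ i ∈ Finset.Icc 1 n, ((D i).card : ℝ≥0∞))⁻¹ := by
    intro q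
    rcases (S q).eq_empty_or_nonempty with h | ⟨e, he⟩
    · simp [h]
    · have hsub : S q ⊆ (Finset.Icc 1 n : Set ℕ).pi fun i => {e i} := by
        intro d hd i hi
        rw [Finset.mem_coe, Finset.mem_Icc] at hi
        exact Subtype.ext (Prod.ext
          (eq_of_prefixNum_eq (fun i _ => (hlt d i).1) (fun i _ => (hlt e i).1)
            (hd.1.trans he.1.symm) hi.1 hi.2)
          (eq_of_prefixNum_eq (fun i _ => (hlt d i).2) (fun i _ => (hlt e i).2)
            (hd.2.trans he.2.symm) hi.1 hi.2))
      refine (measure_mono hsub).trans ?_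
      rw [Measure.infinitePi_pi _ fun _ _ => measurableSet_singleton _,
        ENNReal.prod_inv_distrib fun i _ j _ _ => Or.inl (by simp [(hne i).ne_empty])]
      refine (Finset.prod_congr rfl fun i _ => ?_).le
      rw [PMF.toMeasure_apply_singleton _ _ (measurableSet_singleton _),
        PMF.uniformOfFintype_apply, Fintype.card_coe]
  have hcov : f ⁻¹' Metric.closedBall p δ ⊆ ⋃ q ∈ A ×ˢ B, S q := by
    intro d hd
    have h : max (dist (f d).1 p.1) (dist (f d).2 p.2) ≤ δ := hd
    obtain ⟨h1, h2⟩ := max_le_iff.1 h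
    refine mem_iUnion₂.2 ⟨(_, _), Finset.mem_product.2 ⟨?_, ?_⟩, rfl, rfl⟩
    · exact prefixNum_mem_Icc_of_abs_sub_le (fun i _ => (hlt d i).1) h1 hδ
    · exact prefixNum_mem_Icc_of_abs_sub_le (fun i _ => (hlt d i).2) h2 hδ
  refine (measure_mono hcov).trans ((measure_biUnion_finset_le _ _).trans ?_)
  refine (Finset.sum_le_card_nsmul _ _ _ fun q _ => hS q).trans (le_of_eq ?_)
  rw [Finset.card_product, Nat.card_Icc, Nat.card_Icc, nsmul_eq_mul]
  congr 1
  rw [show ∀ a : ℕ, a + 3 + 1 - a = 4 by omega, show ∀ a : ℕ, a + 3 + 1 - a = 4 by omega]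
  norm_num

lemma exists_pow_three_scale {δ : ℝ} (h0 : 0 < δ) (h1 : δ ≤ 1) :
    ∃ n : ℕ, 1 / 3 ^ (n + 1) < δ ∧ δ ≤ 1 / 3 ^ n := by
  obtain ⟨n, hn, hlt⟩ := exists_nat_pow_near_of_lt_one h0 h1 (y := (1 / 3 : ℝ)) (by norm_num)
    (by norm_num)
  exact ⟨n, by simpa using hn, by simpa using hlt⟩

/-- Mass distribution bound for homogeneous digit sets. -/
theorem le_dimH_digitSet {D : ℕ → Finset (ℕ × ℕ)} (hne : ∀ i, (D i).Nonempty)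
    (hD : ∀ i, D i ⊆ vDigits) {t : ℝ}
    (h : ∀ᶠ n : ℕ in atTop, (3 : ℝ) ^ (t * n) ≤ ∏ i ∈ Finset.Icc 1 n, ((D i).card : ℝ)) :
    ENNReal.ofReal t ≤ dimH (digitSet D) := by
  rcases le_or_gt t 0 with ht | ht
  · simp [ENNReal.ofReal_of_nonpos ht]
  obtain ⟨ν, hν0, hν⟩ := exists_measure_digitSet hne hD
  obtain ⟨n₀, hn₀⟩ := eventually_atTop.1 h
  have hinv : ∀ n ≥ n₀, (∏ i ∈ Finset.Icc 1 n, ((D i).card : ℝ≥0∞))⁻¹ ≤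
      ENNReal.ofReal ((1 / 3 ^ n : ℝ) ^ t) := by
    intro n hn
    have h1 : (∏ i ∈ Finset.Icc 1 n, ((D i).card : ℝ≥0∞)) =
        ENNReal.ofReal (∏ i ∈ Finset.Icc 1 n, ((D i).card : ℝ)) := by
      rw [ENNReal.ofReal_prod_of_nonneg fun i _ => by positivity]
      simp
    have h2 : ((1 / 3 ^ n : ℝ) ^ t) = ((3 : ℝ) ^ (t * n))⁻¹ := by
      rw [one_div, Real.inv_rpow (by positivity), mul_comm, Real.rpow_mul (by norm_num),
        Real.rpow_natCast]
    rw [h1, h2, ENNReal.ofReal_inv_of_pos (by positivity)]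
    exact ENNReal.inv_le_inv.2 (ENNReal.ofReal_le_ofReal (hn₀ n hn))
  set K : ℝ≥0∞ := 16 * ENNReal.ofReal ((3 : ℝ) ^ t) with hK
  have hK0 : K ≠ 0 := by
    simp only [hK, ne_eq, mul_eq_zero, ENNReal.ofReal_eq_zero, not_or, not_le]
    exact ⟨by norm_num, by positivity⟩
  have hKtop : K ≠ ⊤ := ENNReal.mul_ne_top (by norm_num) ENNReal.ofReal_ne_top
  have hle : K⁻¹ • ν ≤ μH[t] := by
    refine Measure.le_hausdorffMeasure t _ (ENNReal.ofReal (1 / 3 ^ n₀))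
      (by simp only [ENNReal.ofReal_pos]; positivity) fun s hs => ?_
    rw [Measure.smul_apply, smul_eq_mul, ENNReal.inv_mul_le_iff hK0 hKtop]
    rcases s.eq_empty_or_nonempty with rfl | ⟨p, hp⟩
    · simp
    have hfin : Metric.ediam s ≠ ⊤ := (hs.trans_lt ENNReal.ofReal_lt_top).ne
    have hball : s ⊆ Metric.closedBall p (Metric.ediam s).toReal := fun x hx => by
      rw [Metric.mem_closedBall, dist_edist]
      exact ENNReal.toReal_mono hfin (Metric.edist_le_ediam_of_mem hx hp)
    have hδ : (Metric.ediam s).toReal ≤ 1 / 3 ^ n₀ :=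
      ENNReal.toReal_le_of_le_ofReal (by positivity) hs
    rw [← ENNReal.ofReal_toReal hfin]
    set δ := (Metric.ediam s).toReal with hδ'
    have hδ0 : 0 ≤ δ := ENNReal.toReal_nonneg
    rcases hδ0.eq_or_lt with h0 | h0
    · have hz : ν s ≤ 0 := by
        have hlim : Tendsto (fun n : ℕ => 16 * ENNReal.ofReal ((1 / 3 ^ n : ℝ) ^ t)) atTop
            (𝓝 (16 * ENNReal.ofReal 0)) := by
          refine ENNReal.Tendsto.const_mul (ENNReal.tendsto_ofReal ?_) (Or.inr (by norm_num))
          have h3 : Tendsto (fun n : ℕ => (1 / 3 ^ n : ℝ)) atTop (𝓝 0) := by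
            simpa using tendsto_pow_atTop_nhds_zero_of_lt_one (r := (1 / 3 : ℝ)) (by norm_num)
              (by norm_num)
          have := h3.rpow_const (p := t) (Or.inr ht.le)
          rwa [Real.zero_rpow ht.ne'] at this
        rw [ENNReal.ofReal_zero, mul_zero] at hlim
        refine ge_of_tendsto hlim ?_
        filter_upwards [eventually_ge_atTop n₀] with n hn
        refine (measure_mono hball).trans ((hν p n δ ?_).trans ?_)
        · rw [← h0]; positivity
        · gcongr; exact hinv n hn
      exact hz.trans (zero_le)
    · obtain ⟨n, hn1, hn2⟩ := exists_pow_three_scale h0 (hδ.trans (by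
        rw [div_le_one (by positivity)]; exact one_le_pow₀ (by norm_num)))
      have hnn : n₀ ≤ n := by
        have h4 : (1 : ℝ) / 3 ^ (n + 1) < 1 / 3 ^ n₀ := hn1.trans_le hδ
        rw [one_div_lt_one_div (by positivity) (by positivity),
          pow_lt_pow_iff_right₀ (by norm_num)] at h4
        omega
      refine (measure_mono hball).trans ((hν p n δ hn2).trans ?_)
      rw [hK, mul_assoc, ENNReal.ofReal_rpow_of_pos h0, ← ENNReal.ofReal_mul (by positivity),
        ← Real.mul_rpow (by norm_num) h0.le]
      gcongr
      refine (hinv n hnn).trans (ENNReal.ofReal_le_ofReal ?_)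
      gcongr
      rw [pow_succ, one_div_lt (by positivity) h0] at hn1
      rw [div_le_iff₀ (by positivity)]
      rw [div_lt_iff₀ h0] at hn1
      nlinarith
  have hne0 : μH[t] (digitSet D) ≠ 0 := fun h0 => by
    have := hle (digitSet D)
    rw [h0, Measure.smul_apply, smul_eq_mul, nonpos_iff_eq_zero, mul_eq_zero] at this
    exact this.elim (ENNReal.inv_ne_zero.2 hKtop) hν0
  have := le_dimH_of_hausdorffMeasure_ne_zero (d := t.toNNReal) (s := digitSet D)
    (by rwa [Real.coe_toNNReal _ ht.le])
  exact this

lemma hausdorffMeasure_limsup_cover_eq_zero {E : Set (ℝ × ℝ)} {C : ℕ → Finset (ℝ × ℝ)}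
    {r : ℕ → ℝ} {s : ℝ} (hs : 0 < s) (hr0 : ∀ n, 0 ≤ r n) (hr : Tendsto r atTop (𝓝 0))
    (hsum : Summable fun n => ((C n).card : ℝ) * (2 * r n) ^ s)
    (hcov : ∀ p ∈ E, ∃ᶠ n in atTop, ∃ c ∈ C n, dist p c ≤ r n) : μH[s] E = 0 := by
  let T : ℕ → (Σ n : ℕ, C n) → Set (ℝ × ℝ) := fun l q =>
    if l ≤ q.1 then Metric.closedBall q.2.1 (r q.1) else ∅
  let g : ℕ → ℝ≥0∞ := fun n => ENNReal.ofReal (((C n).card : ℝ) * (2 * r n) ^ s)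
  have hr2 : Tendsto (fun n => ENNReal.ofReal (2 * r n)) atTop (𝓝 0) := by
    simpa using ENNReal.tendsto_ofReal (hr.const_mul 2)
  obtain ⟨R, hR, hRle⟩ : ∃ R : ℕ → ℝ≥0∞, Tendsto R atTop (𝓝 0) ∧
      ∀ l n, l ≤ n → ENNReal.ofReal (2 * r n) ≤ R l := by
    refine ⟨fun l => ⨆ n ≥ l, ENNReal.ofReal (2 * r n), ?_, fun l n h =>
      le_iSup₂ (f := fun n (_ : n ≥ l) => ENNReal.ofReal (2 * r n)) n h⟩
    rw [ENNReal.tendsto_nhds_zero] at hr2 ⊢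
    intro ε hε
    obtain ⟨N, hN⟩ := eventually_atTop.1 (hr2 ε hε)
    filter_upwards [eventually_ge_atTop N] with l hl
    exact iSup₂_le fun n hn => hN n (hl.trans hn)
  have hdiam : ∀ n (c : ℝ × ℝ), Metric.ediam (Metric.closedBall c (r n)) ≤
      ENNReal.ofReal (2 * r n) := fun n c => by
    rw [← Metric.closedEBall_ofReal (hr0 n), ENNReal.ofReal_mul (by norm_num), ENNReal.ofReal_ofNat]
    exact Metric.ediam_closedEBall_le
  have hle := Measure.hausdorffMeasure_le_liminf_tsum s E (l := atTop) R hR T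
    (Eventually.of_forall fun l q => by
      by_cases h : l ≤ q.1
      · simp only [T, if_pos h]
        exact (hdiam _ _).trans (hRle l _ h)
      · simp [T, if_neg h])
    (Eventually.of_forall fun l p hp => by
      obtain ⟨n, hn, c, hc, hd⟩ := frequently_atTop.1 (hcov p hp) l
      refine mem_iUnion.2 ⟨⟨n, c, hc⟩, ?_⟩
      simp only [T, if_pos hn]
      exact hd)
  have hgfin : ∑' n, g n ≠ ⊤ := by
    rw [← ENNReal.ofReal_tsum_of_nonneg (fun n => by have := hr0 n; positivity) hsum]
    exact ENNReal.ofReal_ne_top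
  have hbd : ∀ l, ∑' q, Metric.ediam (T l q) ^ s ≤ ∑' n, g (n + l) := by
    intro l
    rw [ENNReal.tsum_sigma']
    have h1 : ∀ n, ∑' c : C n, Metric.ediam (T l ⟨n, c⟩) ^ s ≤ if l ≤ n then g n else 0 := by
      intro n
      by_cases h : l ≤ n
      · simp only [T, if_pos h]
        rw [tsum_fintype]
        refine (Finset.sum_le_card_nsmul Finset.univ
          (fun c : C n => Metric.ediam (Metric.closedBall (c : ℝ × ℝ) (r n)) ^ s) _ fun c _ =>
            ENNReal.rpow_le_rpow (hdiam n c) hs.le).trans (le_of_eq ?_)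
        rw [Finset.card_univ, Fintype.card_coe, nsmul_eq_mul,
          ENNReal.ofReal_rpow_of_nonneg (by have := hr0 n; positivity) hs.le,
          ← ENNReal.ofReal_natCast, ← ENNReal.ofReal_mul (by positivity)]
      · simp [T, if_neg h, hs]
    refine (ENNReal.tsum_le_tsum h1).trans (le_of_eq ?_)
    rw [← (ENNReal.summable (f := fun n => if l ≤ n + l then g (n + l) else 0)).sum_add_tsum_nat_add'
        (f := fun n => if l ≤ n then g n else 0),
      Finset.sum_eq_zero fun n hn => if_neg (by simpa using hn), zero_add]
    exact tsum_congr fun n => if_pos (by omega)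
  refine le_antisymm (hle.trans ?_) (zero_le)
  have hlim : Tendsto (fun l => ∑' q, Metric.ediam (T l q) ^ s) atTop (𝓝 0) :=
    tendsto_of_tendsto_of_tendsto_of_le_of_le tendsto_const_nhds
      (ENNReal.tendsto_sum_nat_add g hgfin) (fun _ => zero_le) hbd
  exact hlim.liminf_eq.le

/-- Upper bound for the dimension of a limsup set covered by `3 ^ (n * α + o(n))` balls of radius
`K * 3 ^ (-n * β)`. -/
theorem dimH_le_of_limsup_cover {E : Set (ℝ × ℝ)} {C : ℕ → Finset (ℝ × ℝ)} {α β K : ℝ}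
    (hα : 0 ≤ α) (hβ : 0 < β) (hK : 0 ≤ K)
    (hcard : ∀ ε > 0, ∃ A : ℝ, ∀ n : ℕ, ((C n).card : ℝ) ≤ A * 3 ^ (n * (α + ε)))
    (hcov : ∀ p ∈ E, ∃ᶠ n : ℕ in atTop, ∃ c ∈ C n, dist p c ≤ K * 3 ^ (-(n * β))) :
    dimH E ≤ ENNReal.ofReal (α / β) := by
  refine le_of_forall_gt_imp_ge_of_dense fun b hb => ?_
  rcases eq_or_ne b ⊤ with rfl | hbtop
  · exact le_top
  obtain ⟨s, hsb⟩ : ∃ s : NNReal, (s : ℝ≥0∞) = b := ⟨b.toNNReal, ENNReal.coe_toNNReal hbtop⟩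
  rw [← hsb] at hb ⊢
  have hs : α / β < s := by
    rwa [← ENNReal.ofReal_coe_nnreal, ENNReal.ofReal_lt_ofReal_iff_of_nonneg (by positivity)] at hb
  have hs0 : (0 : ℝ) < s := lt_of_le_of_lt (by positivity) hs
  rw [div_lt_iff₀ hβ] at hs
  refine dimH_le_of_hausdorffMeasure_ne_top ?_
  obtain ⟨A, hA⟩ := hcard ((s * β - α) / 2) (by linarith)
  have hpow : ∀ γ : ℝ, ∀ n : ℕ, (3 : ℝ) ^ (n * γ) = ((3 : ℝ) ^ γ) ^ n := fun γ n => by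
    rw [mul_comm, Real.rpow_mul (by norm_num), Real.rpow_natCast]
  have hzero : μH[(s : ℝ)] E = 0 := by
    refine hausdorffMeasure_limsup_cover_eq_zero (r := fun n : ℕ => K * 3 ^ (-(n * β))) hs0
      (fun n => by positivity) ?_ ?_ hcov
    · have h1 : Tendsto (fun n : ℕ => K * ((3 : ℝ) ^ (-β)) ^ n) atTop (𝓝 (K * 0)) :=
        (tendsto_pow_atTop_nhds_zero_of_lt_one (by positivity)
          (Real.rpow_lt_one_of_one_lt_of_neg (by norm_num) (by linarith))).const_mul K
      rw [mul_zero] at h1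
      refine h1.congr fun n => ?_
      rw [← hpow, mul_neg]
    · have hq : (3 : ℝ) ^ (-((s * β - α) / 2)) < 1 :=
        Real.rpow_lt_one_of_one_lt_of_neg (by norm_num) (by linarith)
      refine Summable.of_nonneg_of_le (fun n => by positivity) (fun n => ?_)
        ((summable_geometric_of_lt_one (by positivity) hq).mul_left (A * (2 * K) ^ (s : ℝ)))
      calc ((C n).card : ℝ) * (2 * (K * 3 ^ (-(n * β)))) ^ (s : ℝ)
          ≤ (A * 3 ^ (n * (α + (s * β - α) / 2))) * (2 * (K * 3 ^ (-(n * β)))) ^ (s : ℝ) := by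
            gcongr; exact hA n
        _ = A * (2 * K) ^ (s : ℝ) * ((3 : ℝ) ^ (-((s * β - α) / 2))) ^ n := by
            rw [← mul_assoc 2 K, Real.mul_rpow (by positivity) (by positivity),
              ← Real.rpow_mul (by norm_num), ← hpow]
            have : (3 : ℝ) ^ (n * (-((s * β - α) / 2))) =
                3 ^ (n * (α + (s * β - α) / 2)) * 3 ^ (-(n * β) * (s : ℝ)) := by
              rw [← Real.rpow_add (by norm_num)]
              congr 1
              ring
            rw [this]
            ring
  rw [hzero]
  exact ENNReal.zero_ne_top

lemma exists_freq_nonOnes {w : ℕ → ℕ} {f₁ : ℝ}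
    (h : Tendsto (fun n : ℕ => (((Finset.Icc 1 n).filter fun i => w i = 1).card : ℝ) / n)
      atTop (𝓝 f₁)) :
    ∃ f : ℝ, 0 ≤ f ∧ ∀ ε > 0, ∃ K : ℝ, ∀ n : ℕ, |(nonOnes w n : ℝ) - f * n| ≤ ε * n + K := by
  have hlim : Tendsto (fun n : ℕ => (nonOnes w n : ℝ) / n) atTop (𝓝 (1 - f₁)) := by
    refine (h.const_sub 1).congr' ?_
    filter_upwards [eventually_ge_atTop 1] with n hn
    have h1 := Finset.card_filter_add_card_filter_not (s := Finset.Icc 1 n) fun i => w i = 1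
    rw [Nat.card_Icc, Nat.add_sub_cancel] at h1
    have hn' : (n : ℝ) ≠ 0 := by positivity
    have h2 : (((Finset.Icc 1 n).filter fun i => w i = 1).card : ℝ) + nonOnes w n = n := by
      unfold nonOnes
      exact_mod_cast h1
    rw [eq_sub_of_add_eq h2, sub_div, div_self hn', sub_sub_cancel]
  refine ⟨1 - f₁, ge_of_tendsto' hlim fun n => by positivity, fun ε hε => ?_⟩
  obtain ⟨n₀, hn₀⟩ := Metric.tendsto_atTop.1 hlim ε hε
  refine ⟨∑ n ∈ Finset.range (n₀ + 1), |(nonOnes w n : ℝ) - (1 - f₁) * n|, fun n => ?_⟩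
  rcases Nat.lt_or_ge n (n₀ + 1) with h1 | h1
  · have := Finset.single_le_sum (f := fun n : ℕ => |(nonOnes w n : ℝ) - (1 - f₁) * n|)
      (fun _ _ => abs_nonneg _) (Finset.mem_range.2 h1)
    have h2 : 0 ≤ ε * n := by positivity
    linarith
  · have h2 := (hn₀ n (by omega)).le
    have hn' : (0 : ℝ) < n := by
      have : 0 < n := by omega
      exact_mod_cast this
    rw [Real.dist_eq, div_sub' hn'.ne', abs_div, abs_of_pos hn', div_le_iff₀ hn',
      mul_comm _ (1 - f₁)] at h2
    exact h2.trans (le_add_of_nonneg_right (Finset.sum_nonneg fun _ _ => abs_nonneg _))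

section Dynamics

lemma fract_three_mul_fract (a : ℝ) : Int.fract (3 * Int.fract a) = Int.fract (3 * a) := by
  rw [Int.fract_eq_fract]
  exact ⟨-(3 * ⌊a⌋), by rw [← Int.self_sub_floor]; push_cast; ring⟩

lemma iterate_Ttilde (p : ℝ × ℝ) {n : ℕ} (hn : 1 ≤ n) :
    Ttilde^[n] p = (Int.fract (3 ^ n * p.1), Int.fract (3 ^ n * p.2)) := by
  induction n, hn using Nat.le_induction with
  | base => simp [Ttilde]
  | succ n _ ih =>
    rw [Function.iterate_succ_apply', ih]
    simp only [Ttilde, fract_three_mul_fract, pow_succ', mul_assoc]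

lemma exists_add_fract_val3 {u : ℕ → ℕ} (hu : ∀ i, 1 ≤ i → u i < 3) :
    ∃ e ∈ Finset.range 2, val3 u = e + Int.fract (val3 u) := by
  rcases (val3_le_one hu).eq_or_lt with h | h
  · exact ⟨1, by simp, by simp [h]⟩
  · exact ⟨0, by simp, by simp [Int.fract_eq_self.2 ⟨val3_nonneg u, h⟩]⟩

lemma exists_digits_fract {u : ℕ → ℕ} (hu : ∀ i, 1 ≤ i → u i < 3) :
    ∃ v : ℕ → ℕ, val3 v = Int.fract (val3 u) ∧
      ∀ i, 1 ≤ i → v i = u i ∨ (u i = 2 ∧ v i = 0) := by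
  rcases (val3_le_one hu).eq_or_lt with h | h
  · refine ⟨fun _ => 0, by rw [h, Int.fract_one]; simp [val3], fun i hi => Or.inr ⟨?_, rfl⟩⟩
    by_contra h2
    exact (val3_lt_one hu hi (by have := hu i hi; omega)).ne h
  · exact ⟨u, (Int.fract_eq_self.2 ⟨val3_nonneg u, h⟩).symm, fun i _ => Or.inl rfl⟩

lemma mem_vDigits_of_replace {q r : ℕ × ℕ} (hq : q ∈ vDigits)
    (h1 : r.1 = q.1 ∨ (q.1 = 2 ∧ r.1 = 0)) (h2 : r.2 = q.2 ∨ (q.2 = 2 ∧ r.2 = 0)) :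
    r ∈ vDigits := by
  obtain ⟨a, b⟩ := r
  simp only [vDigits, Finset.mem_insert, Finset.mem_singleton, Prod.mk.injEq] at hq ⊢
  rcases hq with rfl | rfl | rfl | rfl | rfl <;> simp only at h1 h2 <;> omega

lemma exists_levelSquares_of_mem_V {p : ℝ × ℝ} (hp : p ∈ V) {n : ℕ} (hn : 1 ≤ n) :
    Ttilde^[n] p ∈ V ∧ ∃ q ∈ levelSquares n, ∃ e ∈ Finset.range 2 ×ˢ Finset.range 2,
      3 ^ n * p.1 = q.1 + e.1 + (Ttilde^[n] p).1 ∧ 3 ^ n * p.2 = q.2 + e.2 + (Ttilde^[n] p).2 := by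
  obtain ⟨d, hd, rfl⟩ := hp
  have h1 : ∀ i, 1 ≤ i → (d i).1 < 3 := fun i hi => (lt_three_of_mem_vDigits (hd i hi)).1
  have h2 : ∀ i, 1 ≤ i → (d i).2 < 3 := fun i hi => (lt_three_of_mem_vDigits (hd i hi)).2
  have h1' : ∀ i, 1 ≤ i → (d (i + n)).1 < 3 := fun i hi => h1 _ (by omega)
  have h2' : ∀ i, 1 ≤ i → (d (i + n)).2 < 3 := fun i hi => h2 _ (by omega)
  rw [iterate_Ttilde _ hn]
  simp only
  rw [pow_mul_val3 h1, pow_mul_val3 h2, Int.fract_natCast_add, Int.fract_natCast_add]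
  constructor
  · obtain ⟨a, ha, ha'⟩ := exists_digits_fract h1'
    obtain ⟨b, hb, hb'⟩ := exists_digits_fract h2'
    refine ⟨fun i => (a i, b i), fun i hi => ?_, by rw [← ha, ← hb]⟩
    exact mem_vDigits_of_replace (hd (i + n) (by omega)) (ha' i hi) (hb' i hi)
  · obtain ⟨a, ha, ha'⟩ := exists_add_fract_val3 h1'
    obtain ⟨b, hb, hb'⟩ := exists_add_fract_val3 h2'
    refine ⟨_, prefixNum_mem_levelSquares hd n, (a, b), Finset.mem_product.2 ⟨ha, hb⟩, ?_, ?_⟩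
    · rw [add_assoc, ← ha']
    · rw [add_assoc, ← hb']

lemma exists_near_levelSquares {y₁ y₂ : ℝ} {u w : ℕ → ℕ} (hu : ∀ i, 1 ≤ i → u i < 3)
    (hw : ∀ i, 1 ≤ i → w i < 3) (hy₁ : y₁ = val3 u) (hy₂ : y₂ = val3 w) {z : ℝ × ℝ} (hz : z ∈ V)
    {m k : ℕ} (h1 : |z.1 - y₁| ≤ 1 / 3 ^ m) (h2 : |z.2 - y₂| ≤ 1 / 3 ^ (m + k)) :
    ∃ q ∈ (levelSquares (m + k)).filter (fun q : ℕ × ℕ =>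
      (q.2 ≤ prefixNum w (m + k) + 2 ∧ prefixNum w (m + k) ≤ q.2 + 2) ∧
      (q.1 / 3 ^ k ≤ prefixNum u m + 2 ∧ prefixNum u m ≤ q.1 / 3 ^ k + 2)),
      dist z ((q.1 : ℝ) / 3 ^ (m + k), (q.2 : ℝ) / 3 ^ (m + k)) ≤ 1 / 3 ^ (m + k) := by
  obtain ⟨d, hd, rfl⟩ := hz
  have h3 : ∀ i, 1 ≤ i → (d i).1 < 3 := fun i hi => (lt_three_of_mem_vDigits (hd i hi)).1
  have h4 : ∀ i, 1 ≤ i → (d i).2 < 3 := fun i hi => (lt_three_of_mem_vDigits (hd i hi)).2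
  subst hy₁ hy₂
  simp only at h1 h2
  refine ⟨_, Finset.mem_filter.2 ⟨prefixNum_mem_levelSquares hd (m + k), ⟨?_, ?_⟩, ?_, ?_⟩, ?_⟩
  · exact prefixNum_le_add_two h4 hw h2
  · exact prefixNum_le_add_two hw h4 (by rwa [abs_sub_comm])
  · rw [prefixNum_add_div_pow h3]
    exact prefixNum_le_add_two h3 hu h1
  · rw [prefixNum_add_div_pow h3]
    exact prefixNum_le_add_two hu h3 (by rwa [abs_sub_comm])
  · have key : ∀ v : ℕ → ℕ, (∀ i, 1 ≤ i → v i < 3) →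
        |val3 v - prefixNum v (m + k) / 3 ^ (m + k)| ≤ 1 / 3 ^ (m + k) := by
      intro v hv
      have h5 := prefixNum_le_pow_mul_val3 hv (m + k)
      have h6 := pow_mul_val3_le_prefixNum_add_one hv (m + k)
      have h7 : (0 : ℝ) < 3 ^ (m + k) := by positivity
      rw [sub_div' h7.ne', abs_div, abs_of_pos h7, abs_of_nonneg (by linarith)]
      gcongr
      linarith
    exact max_le (key _ h3) (key _ h4)

end Dynamics

section UpperBounds

open Real in
lemma five_pow_eq (n : ℕ) : (5 : ℝ) ^ n = 3 ^ (n * logb 3 5) := by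
  rw [mul_comm, Real.rpow_mul (by norm_num), Real.rpow_natCast,
    Real.rpow_logb (by norm_num) (by norm_num) (by norm_num)]

open Real in
lemma two_pow_eq (n : ℕ) : (2 : ℝ) ^ n = 3 ^ (n * logb 3 2) := by
  rw [mul_comm, Real.rpow_mul (by norm_num), Real.rpow_natCast,
    Real.rpow_logb (by norm_num) (by norm_num) (by norm_num)]

lemma logb_three_two_pos : 0 < Real.logb 3 2 := Real.logb_pos (by norm_num) (by norm_num)

lemma logb_three_two_le_one : Real.logb 3 2 ≤ 1 := by
  rw [Real.logb_le_iff_le_rpow (by norm_num) (by norm_num)]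
  norm_num

lemma logb_three_five_pos : 0 < Real.logb 3 5 := Real.logb_pos (by norm_num) (by norm_num)

lemma one_div_three_pow_eq (n : ℕ) : (1 : ℝ) / 3 ^ n = 3 ^ (-(n : ℝ)) := by
  rw [Real.rpow_neg (by norm_num), Real.rpow_natCast, one_div]

variable {w : ℕ → ℕ} {f : ℝ}

/-- The number of level squares near a point of the strip grows at the rate given by the digit
frequency. -/
lemma two_pow_lowNonOnes_le (hw : ∀ i, 1 ≤ i → w i < 3)
    (hf : ∀ ε > 0, ∃ K : ℝ, ∀ n : ℕ, |(nonOnes w n : ℝ) - f * n| ≤ ε * n + K) (hf0 : 0 ≤ f)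
    {a b : ℝ} (ha : 0 ≤ a) (hab : a ≤ b) (hb : 0 < b) {ε : ℝ} (hε : 0 < ε) :
    ∃ A : ℝ, ∀ n m k : ℕ, m = ⌊n * a⌋₊ → m + k = ⌊n * b⌋₊ →
      (2 : ℝ) ^ lowNonOnes k (prefixNum w (m + k)) ≤
        A * 3 ^ (n * (f * (b - a) * Real.logb 3 2 + ε)) := by
  obtain ⟨K, hK⟩ := hf (ε / (2 * b)) (by positivity)
  refine ⟨3 ^ (f + 2 * K), fun n m k hm hmk => ?_⟩
  have hK0 : 0 ≤ K := by simpa [nonOnes] using hK 0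
  have h1 := nonOnes_add_lowNonOnes hw m k
  have h2 := (abs_le.1 (hK m)).1
  have h3 := (abs_le.1 (hK (m + k))).2
  have h4 : ((m + k : ℕ) : ℝ) ≤ n * b := hmk ▸ Nat.floor_le (by positivity)
  have h5 : (m : ℝ) ≤ n * a := hm ▸ Nat.floor_le (by positivity)
  have h6 : n * a < m + 1 := hm ▸ Nat.lt_floor_add_one _
  have h7 : (lowNonOnes k (prefixNum w (m + k)) : ℝ) = nonOnes w (m + k) - nonOnes w m := by
    rw [← h1]; push_cast; ring
  have hmb : (m : ℝ) ≤ n * b := h5.trans (by gcongr)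
  have h8 : ε / (2 * b) * ((m + k : ℕ) : ℝ) + ε / (2 * b) * m ≤ n * ε := by
    calc ε / (2 * b) * ((m + k : ℕ) : ℝ) + ε / (2 * b) * m
        ≤ ε / (2 * b) * (n * b) + ε / (2 * b) * (n * b) := by gcongr
      _ = n * ε := by field_simp; ring
  have h9 : f * ((m + k : ℕ) : ℝ) - f * m ≤ f * (n * b - n * a + 1) := by
    rw [← mul_sub]; gcongr; linarith
  have h10 : (lowNonOnes k (prefixNum w (m + k)) : ℝ) ≤
      n * (f * (b - a)) + (f + 2 * K + n * ε) := by
    rw [h7]; linarith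
  rw [two_pow_eq, ← Real.rpow_add (by norm_num)]
  refine Real.rpow_le_rpow_of_exponent_le (by norm_num) ?_
  calc (lowNonOnes k (prefixNum w (m + k)) : ℝ) * Real.logb 3 2
      ≤ (n * (f * (b - a)) + (f + 2 * K + n * ε)) * Real.logb 3 2 := by
        gcongr; exact logb_three_two_pos.le
    _ ≤ n * (f * (b - a)) * Real.logb 3 2 + (f + 2 * K + n * ε) * 1 := by
        rw [add_mul]; gcongr; exact logb_three_two_le_one
    _ = _ := by ring

theorem dimH_V_le : dimH V ≤ ENNReal.ofReal (Real.logb 3 5) := by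
  rw [← div_one (Real.logb 3 5)]
  refine dimH_le_of_limsup_cover (K := 1)
    (C := fun n => (levelSquares n).image fun q => ((q.1 : ℝ) / 3 ^ n, (q.2 : ℝ) / 3 ^ n))
    logb_three_five_pos.le one_pos zero_le_one (fun ε hε => ⟨1, fun n => ?_⟩) fun p hp => ?_
  · rw [one_mul]
    calc (((levelSquares n).image fun q => ((q.1 : ℝ) / 3 ^ n, (q.2 : ℝ) / 3 ^ n)).card : ℝ)
        ≤ (5 : ℝ) ^ n := by exact_mod_cast Finset.card_image_le.trans (card_levelSquares_le n)
      _ ≤ _ := by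
        rw [five_pow_eq]
        gcongr
        · norm_num
        · linarith
  · refine Frequently.of_forall fun n => ?_
    obtain ⟨d, hd, hpd⟩ := id hp
    obtain ⟨q, hq, hdist⟩ := exists_near_levelSquares (z := p) (m := 0) (k := n)
      (fun i hi => (lt_three_of_mem_vDigits (hd i hi)).1)
      (fun i hi => (lt_three_of_mem_vDigits (hd i hi)).2) rfl rfl hp
      (by rw [hpd]; simp) (by rw [hpd]; simp)
    rw [zero_add] at hdist hq
    refine ⟨_, Finset.mem_image_of_mem _ (Finset.mem_filter.1 hq).1, hdist.trans (le_of_eq ?_)⟩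
    rw [one_div_three_pow_eq, one_mul, mul_one]

theorem dimH_slice_le {y₂ : ℝ} (hw : ∀ i, 1 ≤ i → w i < 3) (hrep : y₂ = val3 w)
    (hf : ∀ ε > 0, ∃ K : ℝ, ∀ n : ℕ, |(nonOnes w n : ℝ) - f * n| ≤ ε * n + K) (hf0 : 0 ≤ f) :
    dimH {p : ℝ × ℝ | p ∈ V ∧ p.2 = y₂} ≤ ENNReal.ofReal (f * Real.logb 3 2) := by
  rw [← div_one (f * Real.logb 3 2)]
  refine dimH_le_of_limsup_cover (K := 1)
    (C := fun n => ((levelSquares (0 + n)).filter fun q =>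
      (q.2 ≤ prefixNum w (0 + n) + 2 ∧ prefixNum w (0 + n) ≤ q.2 + 2) ∧
      (q.1 / 3 ^ n ≤ 0 + 2 ∧ 0 ≤ q.1 / 3 ^ n + 2)).image
        fun q => ((q.1 : ℝ) / 3 ^ (0 + n), (q.2 : ℝ) / 3 ^ (0 + n)))
    (mul_nonneg hf0 logb_three_two_pos.le) one_pos zero_le_one (fun ε hε => ?_) fun p hp => ?_
  · obtain ⟨A, hA⟩ := two_pow_lowNonOnes_le hw hf hf0 le_rfl zero_le_one one_pos hε
    refine ⟨100 * A, fun n => ?_⟩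
    have h1 := hA n 0 n (by simp) (by simp)
    rw [sub_zero, mul_one] at h1
    have h2 := (Finset.card_image_le
      (f := fun q : ℕ × ℕ => ((q.1 : ℝ) / 3 ^ (0 + n), (q.2 : ℝ) / 3 ^ (0 + n)))).trans
      (card_levelSquares_near_le 0 n (prefixNum w (0 + n)) 0)
    have h3 : (_ : ℝ) ≤ ((100 * 2 ^ lowNonOnes n (prefixNum w (0 + n)) : ℕ) : ℝ) :=
      Nat.cast_le.2 h2
    refine h3.trans ?_
    push_cast
    rw [mul_assoc]
    gcongr
  · refine Frequently.of_forall fun n => ?_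
    obtain ⟨hpV, hp2⟩ := hp
    obtain ⟨d, hd, hpd⟩ := id hpV
    obtain ⟨q, hq, hdist⟩ := exists_near_levelSquares (z := p) (m := 0) (k := n)
      (fun i hi => (lt_three_of_mem_vDigits (hd i hi)).1) hw rfl hrep hpV
      (by rw [hpd]; simp) (by rw [hp2]; simp)
    refine ⟨_, Finset.mem_image_of_mem _ hq, hdist.trans (le_of_eq ?_)⟩
    rw [one_div_three_pow_eq, zero_add, one_mul, mul_one]

/-- The points of the Vicsek set whose orbit under `Ttilde` enters the `n`-th rectangle around
`(y₁, y₂)` for infinitely many `n`. -/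
def targetSet (lam xi y₁ y₂ : ℝ) : Set (ℝ × ℝ) :=
  {p | p ∈ V ∧ ∃ᶠ n : ℕ in atTop,
    (Ttilde^[n] p).1 ∈
      Icc (y₁ - (3 : ℝ) ^ (-(n : ℝ) * lam)) (y₁ + (3 : ℝ) ^ (-(n : ℝ) * lam)) ∧
    (Ttilde^[n] p).2 ∈
      Icc (y₂ - (3 : ℝ) ^ (-(n : ℝ) * xi)) (y₂ + (3 : ℝ) ^ (-(n : ℝ) * xi))}

lemma dist_div_three_pow_le {p q : ℝ × ℝ} {n : ℕ} {r : ℝ} (h1 : |3 ^ n * p.1 - q.1| ≤ r)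
    (h2 : |3 ^ n * p.2 - q.2| ≤ r) : dist p (q.1 / 3 ^ n, q.2 / 3 ^ n) ≤ r * (1 / 3 ^ n) := by
  have h0 : (0 : ℝ) < 3 ^ n := by positivity
  have key : ∀ a b : ℝ, |3 ^ n * a - b| ≤ r → |a - b / 3 ^ n| ≤ r * (1 / 3 ^ n) := by
    intro a b h
    rw [sub_div' h0.ne', abs_div, abs_of_pos h0, mul_one_div, mul_comm a]
    gcongr
  exact max_le (key _ _ h1) (key _ _ h2)

variable {lam xi y₁ y₂ : ℝ}

theorem dimH_targetSet_le_left (hlam : 0 < lam) (hle : lam ≤ xi) :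
    dimH (targetSet lam xi y₁ y₂) ≤ ENNReal.ofReal (Real.logb 3 5 / (1 + lam)) := by
  refine dimH_le_of_limsup_cover (K := 1)
    (C := fun n => (levelSquares n ×ˢ (Finset.range 2 ×ˢ Finset.range 2)).image fun q =>
      (((q.1.1 : ℝ) + q.2.1 + y₁) / 3 ^ n, ((q.1.2 : ℝ) + q.2.2 + y₂) / 3 ^ n))
    logb_three_five_pos.le (by linarith) zero_le_one (fun ε hε => ⟨4, fun n => ?_⟩) fun p hp => ?_
  · have h1 : (((levelSquares n ×ˢ (Finset.range 2 ×ˢ Finset.range 2)).image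
        fun q : (ℕ × ℕ) × (ℕ × ℕ) => (((q.1.1 : ℝ) + q.2.1 + y₁) / 3 ^ n,
          ((q.1.2 : ℝ) + q.2.2 + y₂) / 3 ^ n)).card : ℝ) ≤ ((5 ^ n * 4 : ℕ) : ℝ) := by
      refine Nat.cast_le.2 (Finset.card_image_le.trans ?_)
      rw [Finset.card_product]
      exact Nat.mul_le_mul (card_levelSquares_le n) (by simp)
    refine h1.trans ?_
    push_cast
    rw [mul_comm, five_pow_eq]
    gcongr
    · norm_num
    · linarith
  · refine (hp.2.and_eventually (eventually_ge_atTop 1)).mono fun n hn => ?_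
    obtain ⟨⟨h1, h2⟩, hn1⟩ := hn
    obtain ⟨-, q, hq, e, he, h3, h4⟩ := exists_levelSquares_of_mem_V hp.1 hn1
    refine ⟨_, Finset.mem_image_of_mem _ (Finset.mem_product.2 ⟨hq, he⟩ :
      ((q, e) : (ℕ × ℕ) × (ℕ × ℕ)) ∈ _), ?_⟩
    have hxi : (3 : ℝ) ^ (-(n : ℝ) * xi) ≤ 3 ^ (-(n : ℝ) * lam) := by
      gcongr ?_ ^ ?_
      · norm_num
      · nlinarith [(Nat.cast_nonneg n : (0 : ℝ) ≤ n)]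
    refine (dist_div_three_pow_le (r := 3 ^ (-(n : ℝ) * lam))
      (q := ((q.1 : ℝ) + e.1 + y₁, (q.2 : ℝ) + e.2 + y₂)) ?_ ?_).trans (le_of_eq ?_)
    · rw [h3, abs_le]; constructor <;> linarith [h1.1, h1.2]
    · rw [h4, abs_le]; constructor <;> linarith [h2.1, h2.2]
    · rw [one_div_three_pow_eq, ← Real.rpow_add (by norm_num), one_mul]
      congr 1
      ring

theorem dimH_targetSet_le_right (hlam : 0 < lam) (hle : lam ≤ xi) (hy : (y₁, y₂) ∈ V)
    (hw : ∀ i, 1 ≤ i → w i < 3) (hrep : y₂ = val3 w)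
    (hf : ∀ ε > 0, ∃ K : ℝ, ∀ n : ℕ, |(nonOnes w n : ℝ) - f * n| ≤ ε * n + K) (hf0 : 0 ≤ f) :
    dimH (targetSet lam xi y₁ y₂) ≤
      ENNReal.ofReal ((Real.logb 3 5 + (xi - lam) * (f * Real.logb 3 2)) / (1 + xi)) := by
  obtain ⟨d, hd, hyd⟩ := hy
  have hu : ∀ i, 1 ≤ i → (d i).1 < 3 := fun i hi => (lt_three_of_mem_vDigits (hd i hi)).1
  have hxi : 0 < xi := hlam.trans_le hle
  have hfloor : ∀ n : ℕ, ∃ k, ⌊n * lam⌋₊ + k = ⌊n * xi⌋₊ := fun n =>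
    Nat.exists_eq_add_of_le (Nat.floor_mono (by gcongr)) |>.imp fun _ h => h.symm
  choose k hk using hfloor
  let W : ℕ → Finset (ℕ × ℕ) := fun n => (levelSquares (⌊n * lam⌋₊ + k n)).filter fun q =>
    (q.2 ≤ prefixNum w (⌊n * lam⌋₊ + k n) + 2 ∧ prefixNum w (⌊n * lam⌋₊ + k n) ≤ q.2 + 2) ∧
    (q.1 / 3 ^ k n ≤ prefixNum (fun i => (d i).1) ⌊n * lam⌋₊ + 2 ∧
      prefixNum (fun i => (d i).1) ⌊n * lam⌋₊ ≤ q.1 / 3 ^ k n + 2)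
  let g : ℕ → ((ℕ × ℕ) × (ℕ × ℕ)) × (ℕ × ℕ) → ℝ × ℝ := fun n q =>
    (((q.1.1.1 : ℝ) + q.1.2.1 + q.2.1 / 3 ^ (⌊n * lam⌋₊ + k n)) / 3 ^ n,
      ((q.1.1.2 : ℝ) + q.1.2.2 + q.2.2 / 3 ^ (⌊n * lam⌋₊ + k n)) / 3 ^ n)
  refine dimH_le_of_limsup_cover (K := 3) (C := fun n =>
    ((levelSquares n ×ˢ (Finset.range 2 ×ˢ Finset.range 2)) ×ˢ W n).image (g n))
    (by have := logb_three_five_pos; have := logb_three_two_pos; have := sub_nonneg.2 hle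
        positivity) (by linarith) (by norm_num) (fun ε hε => ?_) fun p hp => ?_
  · obtain ⟨A, hA⟩ := two_pow_lowNonOnes_le hw hf hf0 hlam.le hle hxi hε
    refine ⟨400 * A, fun n => ?_⟩
    have h1 : ((((levelSquares n ×ˢ (Finset.range 2 ×ˢ Finset.range 2)) ×ˢ W n).image
        (g n)).card : ℝ) ≤
        ((5 ^ n * 4 * (100 * 2 ^ lowNonOnes (k n) (prefixNum w (⌊n * lam⌋₊ + k n))) : ℕ) : ℝ) := by
      refine Nat.cast_le.2 (Finset.card_image_le.trans ?_)
      rw [Finset.card_product, Finset.card_product]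
      exact Nat.mul_le_mul (Nat.mul_le_mul (card_levelSquares_le n) (by simp))
        (card_levelSquares_near_le _ _ _ _)
    refine h1.trans ?_
    push_cast
    calc (5 : ℝ) ^ n * 4 * (100 * 2 ^ lowNonOnes (k n) (prefixNum w (⌊n * lam⌋₊ + k n)))
        ≤ (5 : ℝ) ^ n * 4 * (100 * (A * 3 ^ (n * (f * (xi - lam) * Real.logb 3 2 + ε)))) := by
          gcongr
          exact hA n _ _ rfl (hk n)
      _ = 400 * A * (3 ^ (n * Real.logb 3 5) *
            3 ^ (n * (f * (xi - lam) * Real.logb 3 2 + ε))) := by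
          rw [five_pow_eq]; ring
      _ = _ := by
          rw [← Real.rpow_add (by norm_num)]
          congr 2
          ring
  · refine (hp.2.and_eventually (eventually_ge_atTop 1)).mono fun n hn => ?_
    obtain ⟨⟨h1, h2⟩, hn1⟩ := hn
    obtain ⟨hz, q, hq, e, he, h3, h4⟩ := exists_levelSquares_of_mem_V hp.1 hn1
    have hsmall : ∀ a : ℝ, 0 ≤ a → (3 : ℝ) ^ (-(n : ℝ) * a) ≤ 1 / 3 ^ ⌊n * a⌋₊ := by
      intro a ha
      rw [one_div_three_pow_eq]
      gcongr ?_ ^ ?_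
      · norm_num
      · rw [neg_mul, neg_le_neg_iff]
        exact Nat.floor_le (by positivity)
    have hz2 : |(Ttilde^[n] p).2 - y₂| ≤ 1 / 3 ^ (⌊n * lam⌋₊ + k n) := by
      rw [hk]
      exact (abs_le.2 ⟨by linarith [h2.1], by linarith [h2.2]⟩).trans (hsmall xi hxi.le)
    obtain ⟨v, hv, hdist⟩ := exists_near_levelSquares (y₁ := y₁) (y₂ := y₂) (m := ⌊n * lam⌋₊)
      (k := k n) hu hw (congrArg Prod.fst hyd) hrep hz
      ((abs_le.2 ⟨by linarith [h1.1], by linarith [h1.2]⟩).trans (hsmall lam hlam.le)) hz2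
    refine ⟨_, Finset.mem_image_of_mem _ (Finset.mem_product.2
      ⟨Finset.mem_product.2 ⟨hq, he⟩, hv⟩ : (((q, e), v) : ((ℕ × ℕ) × (ℕ × ℕ)) × (ℕ × ℕ)) ∈ _), ?_⟩
    obtain ⟨h5, h6⟩ := max_le_iff.1 hdist
    rw [Real.dist_eq] at h5 h6
    refine (dist_div_three_pow_le (r := 1 / 3 ^ (⌊n * lam⌋₊ + k n))
      (q := ((q.1 : ℝ) + e.1 + v.1 / 3 ^ (⌊n * lam⌋₊ + k n),
        (q.2 : ℝ) + e.2 + v.2 / 3 ^ (⌊n * lam⌋₊ + k n))) ?_ ?_).trans ?_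
    · rw [h3, add_sub_add_left_eq_sub]; exact h5
    · rw [h4, add_sub_add_left_eq_sub]; exact h6
    · rw [hk, one_div_three_pow_eq, one_div_three_pow_eq, ← Real.rpow_add (by norm_num)]
      have h7 : (3 : ℝ) * 3 ^ (-(n * (1 + xi))) = 3 ^ (1 + -(n * (1 + xi))) := by
        rw [Real.rpow_add (by norm_num), Real.rpow_one]
      rw [h7]
      gcongr ?_ ^ ?_
      · norm_num
      · linarith [Nat.lt_floor_add_one (n * xi)]

end UpperBounds

section LowerBounds

/-- The partial sums of the base-3 logarithms of the numbers of choices at each position. -/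
def logCount (D : ℕ → Finset (ℕ × ℕ)) (n : ℕ) : ℝ :=
  ∑ i ∈ Finset.Icc 1 n, Real.logb 3 ((D i).card : ℝ)

/-- The digit pairs of the Vicsek set with second component `b`. -/
def rowDigits (b : ℕ) : Finset (ℕ × ℕ) := vDigits.filter fun q => q.2 = b

lemma logCount_succ (D : ℕ → Finset (ℕ × ℕ)) (n : ℕ) :
    logCount D (n + 1) = logCount D n + Real.logb 3 ((D (n + 1)).card : ℝ) :=
  Finset.sum_Icc_succ_top (by omega) _

lemma logb_card_nonneg (s : Finset (ℕ × ℕ)) : 0 ≤ Real.logb 3 (s.card : ℝ) := by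
  rcases s.card.eq_zero_or_pos with h | h
  · simp [h]
  · exact Real.logb_nonneg (by norm_num) (by exact_mod_cast h)

lemma logCount_mono (D : ℕ → Finset (ℕ × ℕ)) : Monotone (logCount D) :=
  monotone_nat_of_le_succ fun n => by
    rw [logCount_succ]
    linarith [logb_card_nonneg (D (n + 1))]

lemma logCount_nonneg (D : ℕ → Finset (ℕ × ℕ)) (n : ℕ) : 0 ≤ logCount D n :=
  Finset.sum_nonneg fun _ _ => logb_card_nonneg _

lemma logb_card_rowDigits {b : ℕ} (hb : b < 3) :
    Real.logb 3 ((rowDigits b).card : ℝ) = (if b = 1 then 0 else 1 : ℕ) * Real.logb 3 2 := by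
  rw [rowDigits, card_filter_vDigits hb]
  push_cast
  rw [Real.logb_pow]
  simp

lemma logb_card_vDigits : Real.logb 3 (vDigits.card : ℝ) = Real.logb 3 5 := by
  rw [show vDigits.card = 5 by decide]
  norm_num

lemma le_dimH_digitSet_of_logCount {D : ℕ → Finset (ℕ × ℕ)} (hne : ∀ i, (D i).Nonempty)
    (hD : ∀ i, D i ⊆ vDigits) {t : ℝ} (h : ∀ᶠ n : ℕ in atTop, t * n ≤ logCount D n) :
    ENNReal.ofReal t ≤ dimH (digitSet D) := by
  refine le_dimH_digitSet hne hD (h.mono fun n hn => ?_)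
  refine (Real.rpow_le_rpow_of_exponent_le (by norm_num) hn).trans (le_of_eq ?_)
  rw [logCount, Real.rpow_sum_of_pos (by norm_num)]
  refine Finset.prod_congr rfl fun i _ => ?_
  exact Real.rpow_logb (by norm_num) (by norm_num) (by exact_mod_cast (hne i).card_pos)

lemma digitSet_subset_V {D : ℕ → Finset (ℕ × ℕ)} (hD : ∀ i, D i ⊆ vDigits) :
    digitSet D ⊆ V := fun _ ⟨d, hd, hp⟩ => ⟨d, fun i hi => hD i (hd i hi), hp⟩

lemma exists_digits_of_mem_V {p : ℝ × ℝ} (hp : p ∈ V) :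
    ∃ d : ℕ → ℕ × ℕ, (∀ i, d i ∈ vDigits) ∧
      p = (val3 (fun i => (d i).1), val3 (fun i => (d i).2)) := by
  obtain ⟨d, hd, rfl⟩ := hp
  exact ⟨fun i => d (max 1 i), fun i => hd _ (le_max_left _ _), by simp [val3]⟩

theorem le_dimH_V : ENNReal.ofReal (Real.logb 3 5) ≤ dimH V := by
  refine le_dimH_digitSet_of_logCount (D := fun _ => vDigits) (fun _ => ⟨(0, 0), by decide⟩)
    (fun _ => subset_rfl) (Eventually.of_forall fun n => ?_)
  simp only [logCount, logb_card_vDigits, Finset.sum_const, Nat.card_Icc, Nat.add_sub_cancel,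
    nsmul_eq_mul]
  rw [mul_comm]

lemma rowDigits_nonempty {q : ℕ × ℕ} (hq : q ∈ vDigits) : (rowDigits q.2).Nonempty :=
  ⟨q, Finset.mem_filter.2 ⟨hq, rfl⟩⟩

variable {f : ℝ} {d : ℕ → ℕ × ℕ}

theorem le_dimH_slice (hd : ∀ i, d i ∈ vDigits)
    (hf : ∀ ε > 0, ∃ K : ℝ, ∀ n : ℕ,
      |(nonOnes (fun i => (d i).2) n : ℝ) - f * n| ≤ ε * n + K) :
    ENNReal.ofReal (f * Real.logb 3 2) ≤
      dimH {p : ℝ × ℝ | p ∈ V ∧ p.2 = val3 fun i => (d i).2} := by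
  set D : ℕ → Finset (ℕ × ℕ) := fun i => rowDigits (d i).2 with hDdef
  have hD : ∀ i, D i ⊆ vDigits := fun i => Finset.filter_subset _ _
  have hsub : digitSet D ⊆ {p : ℝ × ℝ | p ∈ V ∧ p.2 = val3 fun i => (d i).2} := by
    intro p hp
    refine ⟨digitSet_subset_V hD hp, ?_⟩
    obtain ⟨e, he, rfl⟩ := hp
    refine tsum_congr fun i => ?_
    beta_reduce
    rw [(Finset.mem_filter.1 (he (i + 1) (by omega))).2]
  refine le_trans ?_ (dimH_mono hsub)
  have hL : ∀ n, logCount D n = nonOnes (fun i => (d i).2) n * Real.logb 3 2 := by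
    intro n
    induction n with
    | zero => simp [logCount, nonOnes]
    | succ n ih =>
      rw [logCount_succ, nonOnes_succ, ih, hDdef,
        logb_card_rowDigits (lt_three_of_mem_vDigits (hd _)).2]
      push_cast
      ring
  have hτ := logb_three_two_pos
  refine le_of_forall_lt_imp_le_of_dense fun b hb => ?_
  obtain ⟨t, -, htb, ht⟩ := ENNReal.lt_iff_exists_real_btwn.1 hb
  refine htb.le.trans (le_dimH_digitSet_of_logCount (fun i => rowDigits_nonempty (hd i)) hD ?_)
  have ht' : t < f * Real.logb 3 2 := (ENNReal.ofReal_lt_ofReal_iff'.1 ht).1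
  set δ := (f * Real.logb 3 2 - t) / 2 with hδ
  have hδ0 : 0 < δ := by linarith
  obtain ⟨K, hK⟩ := hf (δ / Real.logb 3 2) (by positivity)
  filter_upwards [eventually_ge_atTop ⌈K * Real.logb 3 2 / δ⌉₊] with n hn
  have h1 := (div_le_iff₀ hδ0).1 (Nat.ceil_le.1 hn)
  have h2 := mul_le_mul_of_nonneg_right (abs_le.1 (hK n)).1 hτ.le
  have h3 : δ / Real.logb 3 2 * n * Real.logb 3 2 = δ * n := by field_simp
  rw [hL]
  have h4 : (f * Real.logb 3 2 - t) * n = 2 * (δ * n) := by rw [hδ]; ring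
  linarith

/-- The starting position of the `k`-th block, `2 ^ 2 ^ k`. -/
def blockStart (k : ℕ) : ℕ := 2 ^ 2 ^ k

lemma blockStart_succ (k : ℕ) : blockStart (k + 1) = blockStart k ^ 2 := by
  rw [blockStart, blockStart, ← pow_mul, pow_succ]

lemma two_le_blockStart (k : ℕ) : 2 ≤ blockStart k :=
  Nat.le_self_pow (by positivity) 2

lemma lt_blockStart (k : ℕ) : k < blockStart k :=
  Nat.lt_two_pow_self.trans Nat.lt_two_pow_self

lemma tendsto_blockStart : Tendsto (fun k => (blockStart k : ℝ)) atTop atTop :=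
  tendsto_natCast_atTop_atTop.comp
    (tendsto_atTop_mono (fun k => (lt_blockStart k).le) tendsto_id)

/-- The index of the block containing position `i`. -/
def blockIndex (i : ℕ) : ℕ := Nat.log 2 (Nat.log 2 i)

lemma blockIndex_eq {i k : ℕ} (h1 : blockStart k ≤ i) (h2 : i < blockStart (k + 1)) :
    blockIndex i = k := by
  have hi : i ≠ 0 := by have := two_le_blockStart k; omega
  have h3 : 2 ^ k ≤ Nat.log 2 i := (Nat.le_log_iff_pow_le (by norm_num) hi).2 h1
  have h4 : Nat.log 2 i < 2 ^ (k + 1) := (Nat.log_lt_iff_lt_pow (by norm_num) hi).2 h2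
  have h5 : Nat.log 2 i ≠ 0 := by have := Nat.one_le_two_pow (n := k); omega
  exact le_antisymm (Nat.lt_succ_iff.1 ((Nat.log_lt_iff_lt_pow (by norm_num) h5).2 h4))
    ((Nat.le_log_iff_pow_le (by norm_num) h5).2 h3)

lemma exists_block {i k₀ : ℕ} (hi : blockStart k₀ ≤ i) :
    ∃ k ≥ k₀, blockStart k ≤ i ∧ i < blockStart (k + 1) := by
  have hex : ∃ k, i < blockStart k := ⟨i, lt_blockStart i⟩
  have hmono : Monotone blockStart := fun a b hab =>
    Nat.pow_le_pow_right (by norm_num) (Nat.pow_le_pow_right (by norm_num) hab)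
  have h1 := Nat.find_spec hex
  have h2 : k₀ < Nat.find hex := by
    by_contra! h
    exact absurd (hmono h) (by omega)
  refine ⟨Nat.find hex - 1, by omega, not_lt.1 (Nat.find_min hex (by omega)), ?_⟩
  rwa [Nat.sub_add_cancel (by omega)]

/-- Digit choices producing points whose orbit is close to the point coded by `d` at the times
`blockStart k`. -/
def targetDigits (d : ℕ → ℕ × ℕ) (lam xi : ℝ) (i : ℕ) : Finset (ℕ × ℕ) :=
  if i ≤ blockStart (blockIndex i) then {(0, 0)}
  else if i - blockStart (blockIndex i) ≤ ⌈lam * blockStart (blockIndex i)⌉₊ then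
    {d (i - blockStart (blockIndex i))}
  else if i - blockStart (blockIndex i) ≤ ⌈xi * blockStart (blockIndex i)⌉₊ then
    rowDigits (d (i - blockStart (blockIndex i))).2
  else vDigits

variable {lam xi : ℝ}

lemma targetDigits_nonempty (hd : ∀ i, d i ∈ vDigits) (i : ℕ) :
    (targetDigits d lam xi i).Nonempty := by
  unfold targetDigits
  split_ifs
  · exact Finset.singleton_nonempty _
  · exact Finset.singleton_nonempty _
  · exact rowDigits_nonempty (hd _)
  · exact ⟨(0, 0), by decide⟩

lemma targetDigits_subset (hd : ∀ i, d i ∈ vDigits) (i : ℕ) :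
    targetDigits d lam xi i ⊆ vDigits := by
  unfold targetDigits
  split_ifs
  · exact Finset.singleton_subset_iff.2 (by decide)
  · exact Finset.singleton_subset_iff.2 (hd _)
  · exact Finset.filter_subset _ _
  · exact subset_rfl

lemma targetDigits_blockStart (k : ℕ) : targetDigits d lam xi (blockStart k) = {(0, 0)} := by
  have h : blockStart k < blockStart (k + 1) := by
    rw [blockStart_succ]; nlinarith [two_le_blockStart k]
  rw [targetDigits, blockIndex_eq le_rfl h, if_pos le_rfl]

lemma targetDigits_of_le_lam {k j : ℕ} (hj : 1 ≤ j) (hjk : blockStart k + j < blockStart (k + 1))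
    (h : j ≤ ⌈lam * blockStart k⌉₊) : targetDigits d lam xi (blockStart k + j) = {d j} := by
  rw [targetDigits, blockIndex_eq (by omega) hjk, if_neg (by omega), Nat.add_sub_cancel_left,
    if_pos h]

lemma targetDigits_of_le_xi {k j : ℕ} (hjk : blockStart k + j < blockStart (k + 1))
    (h : ⌈lam * blockStart k⌉₊ < j) (h' : j ≤ ⌈xi * blockStart k⌉₊) :
    targetDigits d lam xi (blockStart k + j) = rowDigits (d j).2 := by
  rw [targetDigits, blockIndex_eq (by omega) hjk, if_neg (by omega), Nat.add_sub_cancel_left,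
    if_neg (by omega), if_pos h']

lemma targetDigits_of_xi_lt {k j : ℕ} (hjk : blockStart k + j < blockStart (k + 1))
    (hle : lam ≤ xi) (h : ⌈xi * blockStart k⌉₊ < j) :
    targetDigits d lam xi (blockStart k + j) = vDigits := by
  have : ⌈lam * blockStart k⌉₊ ≤ ⌈xi * (blockStart k : ℝ)⌉₊ := Nat.ceil_mono (by gcongr)
  rw [targetDigits, blockIndex_eq (by omega) hjk, if_neg (by omega), Nat.add_sub_cancel_left,
    if_neg (by omega), if_neg (by omega)]

lemma snd_eq_of_mem_targetDigits {k j : ℕ} {q : ℕ × ℕ} (hj : 1 ≤ j)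
    (hjk : blockStart k + j < blockStart (k + 1)) (h : j ≤ ⌈xi * blockStart k⌉₊)
    (hq : q ∈ targetDigits d lam xi (blockStart k + j)) : q.2 = (d j).2 := by
  rcases le_or_gt j ⌈lam * blockStart k⌉₊ with h1 | h1
  · rw [targetDigits_of_le_lam hj hjk h1, Finset.mem_singleton] at hq
    rw [hq]
  · rw [targetDigits_of_le_xi hjk h1 h] at hq
    exact (Finset.mem_filter.1 hq).2

lemma eventually_block_fits (xi : ℝ) :
    ∀ᶠ k in atTop, blockStart k + ⌈xi * blockStart k⌉₊ < blockStart (k + 1) := by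
  filter_upwards [tendsto_blockStart.eventually_ge_atTop (|xi| + 3)] with k hk
  have h0 : (0 : ℝ) ≤ blockStart k := Nat.cast_nonneg _
  have h1 : xi * blockStart k ≤ |xi| * blockStart k := by gcongr; exact le_abs_self xi
  have h2 : (⌈xi * blockStart k⌉₊ : ℝ) ≤ |xi| * blockStart k + 1 :=
    (Nat.cast_le.2 (Nat.ceil_mono h1)).trans (Nat.ceil_lt_add_one (by positivity)).le
  have h3 : ((blockStart k + ⌈xi * blockStart k⌉₊ : ℕ) : ℝ) < (blockStart (k + 1) : ℕ) := by
    rw [blockStart_succ]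
    push_cast
    nlinarith [abs_nonneg xi]
  exact_mod_cast h3

lemma digitSet_targetDigits_subset (hle : lam ≤ xi) (hd : ∀ i, d i ∈ vDigits) :
    digitSet (targetDigits d lam xi) ⊆
      targetSet lam xi (val3 fun i => (d i).1) (val3 fun i => (d i).2) := by
  intro p hp
  refine ⟨digitSet_subset_V (targetDigits_subset hd) hp, frequently_atTop.2 fun N => ?_⟩
  obtain ⟨e, he, rfl⟩ := hp
  obtain ⟨k, hfit, hkN⟩ := ((eventually_block_fits xi).and (eventually_ge_atTop N)).exists
  have hb := two_le_blockStart k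
  set b := blockStart k with hbdef
  have hev : ∀ i, 1 ≤ i → e i ∈ vDigits := fun i hi => targetDigits_subset hd i (he i hi)
  have he1 : ∀ i, 1 ≤ i → (e i).1 < 3 := fun i hi => (lt_three_of_mem_vDigits (hev i hi)).1
  have he2 : ∀ i, 1 ≤ i → (e i).2 < 3 := fun i hi => (lt_three_of_mem_vDigits (hev i hi)).2
  have hd1 : ∀ i, 1 ≤ i → (d i).1 < 3 := fun i _ => (lt_three_of_mem_vDigits (hd i)).1
  have hd2 : ∀ i, 1 ≤ i → (d i).2 < 3 := fun i _ => (lt_three_of_mem_vDigits (hd i)).2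
  have hs1 : ∀ i, 1 ≤ i → (e (i + b)).1 < 3 := fun i hi => he1 _ (by omega)
  have hs2 : ∀ i, 1 ≤ i → (e (i + b)).2 < 3 := fun i hi => he2 _ (by omega)
  have hzero : e (blockStart (k + 1) - b + b) = (0, 0) := by
    rw [Nat.sub_add_cancel (by omega)]
    have := he (blockStart (k + 1)) (by omega)
    rwa [targetDigits_blockStart, Finset.mem_singleton] at this
  have hmM : ⌈lam * b⌉₊ ≤ ⌈xi * (b : ℝ)⌉₊ := Nat.ceil_mono (by gcongr)
  have hpow : ∀ a : ℝ, (1 : ℝ) / 3 ^ ⌈a * b⌉₊ ≤ 3 ^ (-(b : ℝ) * a) := by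
    intro a
    rw [one_div_three_pow_eq]
    gcongr ?_ ^ ?_
    · norm_num
    · rw [neg_mul, neg_le_neg_iff, mul_comm]
      exact Nat.le_ceil _
  refine ⟨b, le_trans hkN (lt_blockStart k).le, ?_⟩
  rw [iterate_Ttilde _ (by omega : 1 ≤ b)]
  simp only
  rw [pow_mul_val3 he1, pow_mul_val3 he2, Int.fract_natCast_add, Int.fract_natCast_add,
    Int.fract_eq_self.2 ⟨val3_nonneg _, val3_lt_one hs1 (j := blockStart (k + 1) - b) (by omega)
      (by rw [hzero]; norm_num)⟩,
    Int.fract_eq_self.2 ⟨val3_nonneg _, val3_lt_one hs2 (j := blockStart (k + 1) - b) (by omega)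
      (by rw [hzero]; norm_num)⟩]
  constructor
  · have h := abs_le.1 ((abs_val3_sub_le hs1 hd1 (n := ⌈lam * b⌉₊) fun i hi him => by
      have := he (b + i) (by omega)
      rw [hbdef, targetDigits_of_le_lam hi (by omega) him, Finset.mem_singleton] at this
      rw [add_comm, this]).trans (hpow lam))
    exact ⟨by linarith [h.1], by linarith [h.2]⟩
  · have h := abs_le.1 ((abs_val3_sub_le hs2 hd2 (n := ⌈xi * b⌉₊) fun i hi him => by
      rw [add_comm]
      exact snd_eq_of_mem_targetDigits hi (by omega) him (he (b + i) (by omega))).trans (hpow xi))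
    exact ⟨by linarith [h.1], by linarith [h.2]⟩

lemma logCount_row (hd : ∀ i, d i ∈ vDigits) {k m j : ℕ} (hm : m = ⌈lam * blockStart k⌉₊)
    (hj : m + j ≤ ⌈xi * blockStart k⌉₊) (hjk : blockStart k + (m + j) < blockStart (k + 1)) :
    logCount (targetDigits d lam xi) (blockStart k + m) +
      ((nonOnes (fun i => (d i).2) (m + j) : ℝ) - nonOnes (fun i => (d i).2) m) * Real.logb 3 2 ≤
    logCount (targetDigits d lam xi) (blockStart k + (m + j)) := by
  induction j with
  | zero => simp
  | succ j ih =>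
    have ih := ih (by omega) (by omega)
    rw [← add_assoc m, nonOnes_succ, ← add_assoc (blockStart k), logCount_succ,
      add_assoc (blockStart k), targetDigits_of_le_xi (by omega) (by omega) (by omega),
      logb_card_rowDigits (lt_three_of_mem_vDigits (hd _)).2]
    push_cast at ih ⊢
    linarith

lemma logCount_full (hle : lam ≤ xi) {k M j : ℕ} (hM : M = ⌈xi * blockStart k⌉₊)
    (hjk : blockStart k + (M + j) < blockStart (k + 1)) :
    logCount (targetDigits d lam xi) (blockStart k + M) + j * Real.logb 3 5 ≤
      logCount (targetDigits d lam xi) (blockStart k + (M + j)) := by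
  induction j with
  | zero => simp
  | succ j ih =>
    have ih := ih (by omega)
    rw [← add_assoc M, ← add_assoc (blockStart k), logCount_succ,
      add_assoc (blockStart k), targetDigits_of_xi_lt (by omega) hle (by omega),
      logb_card_vDigits]
    push_cast at ih ⊢
    linarith

lemma logCount_blockStart_succ_ge (hle : lam ≤ xi) (hxi : 0 ≤ xi) (k : ℕ) :
    Real.logb 3 5 * (blockStart (k + 1) - ((1 + xi) * blockStart k + 2)) ≤
      logCount (targetDigits d lam xi) (blockStart (k + 1)) := by
  have hs := logb_three_five_pos
  have hceil : (⌈xi * blockStart k⌉₊ : ℝ) < xi * blockStart k + 1 :=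
    Nat.ceil_lt_add_one (by positivity)
  rcases le_or_gt (blockStart (k + 1)) (blockStart k + ⌈xi * (blockStart k : ℝ)⌉₊) with h | h
  · have h1 : (blockStart (k + 1) : ℝ) ≤ blockStart k + ⌈xi * (blockStart k : ℝ)⌉₊ := by
      exact_mod_cast h
    refine le_trans ?_ (logCount_nonneg _ _)
    exact mul_nonpos_of_nonneg_of_nonpos hs.le (by linarith)
  · obtain ⟨j, hj⟩ := Nat.exists_eq_add_of_lt h
    have h1 := logCount_full (d := d) hle (k := k) (j := j) rfl (by omega)
    have h2 := logCount_mono (targetDigits d lam xi)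
      (show blockStart k + (⌈xi * (blockStart k : ℝ)⌉₊ + j) ≤ blockStart (k + 1) by omega)
    have h3 := logCount_nonneg (targetDigits d lam xi) (blockStart k + ⌈xi * (blockStart k : ℝ)⌉₊)
    have h4 : (blockStart (k + 1) : ℝ) = blockStart k + ⌈xi * (blockStart k : ℝ)⌉₊ + j + 1 := by
      exact_mod_cast hj
    have h5 : Real.logb 3 5 * (blockStart (k + 1) - ((1 + xi) * blockStart k + 2)) ≤
        Real.logb 3 5 * j := by
      gcongr
      linarith
    linarith

lemma eventually_logCount_blockStart_ge (hle : lam ≤ xi) (hxi : 0 ≤ xi) {δ : ℝ} (hδ : 0 < δ) :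
    ∀ᶠ k in atTop, (Real.logb 3 5 - δ) * blockStart k ≤
      logCount (targetDigits d lam xi) (blockStart k) := by
  have hs := logb_three_five_pos
  rw [← map_add_atTop_eq_nat 1, eventually_map]
  filter_upwards [tendsto_blockStart.eventually_ge_atTop (Real.logb 3 5 * (3 + xi) / δ)] with k hk
  refine le_trans ?_ (logCount_blockStart_succ_ge hle hxi k)
  rw [div_le_iff₀ hδ] at hk
  have h1 : (1 : ℝ) ≤ blockStart k := by
    exact_mod_cast (two_le_blockStart k).trans' one_le_two
  rw [blockStart_succ]
  push_cast
  have h2 : Real.logb 3 5 * ((1 + xi) * blockStart k + 2) ≤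
      Real.logb 3 5 * (3 + xi) * blockStart k := by
    rw [mul_assoc]
    gcongr
    linarith
  nlinarith [mul_le_mul_of_nonneg_right hk (zero_le_one.trans h1)]

lemma linear_interpolation_ge {s g t a lo hi j η c : ℝ} (hlo : 2 * η ≤ s - t * (a + lo))
    (hhi : 2 * η ≤ s + (hi - lo) * g - t * (a + hi)) (hg : 0 ≤ g) (ht : 0 ≤ t) (hc : 0 ≤ c)
    (h1 : lo * c ≤ j) (h2 : j ≤ hi * c + 1) :
    2 * η * c - t ≤ s * c + g * (j - lo * c) - t * (a * c + j) := by
  rcases le_or_gt t g with h | h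
  · nlinarith [mul_le_mul_of_nonneg_right hlo hc, mul_nonneg (sub_nonneg.2 h) (sub_nonneg.2 h1)]
  · nlinarith [mul_le_mul_of_nonneg_right hhi hc,
      mul_nonneg (sub_nonneg.2 h.le) (sub_nonneg.2 h2)]

lemma eventually_le_logCount_targetDigits (hlam : 0 < lam) (hle : lam ≤ xi)
    (hd : ∀ i, d i ∈ vDigits) (hf0 : 0 ≤ f)
    (hf : ∀ ε > 0, ∃ K : ℝ, ∀ n : ℕ,
      |(nonOnes (fun i => (d i).2) n : ℝ) - f * n| ≤ ε * n + K) {t η : ℝ} (ht : 0 ≤ t)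
    (hη : 0 < η) (h1 : 2 * η ≤ Real.logb 3 5 - t * (1 + lam))
    (h2 : 2 * η ≤ Real.logb 3 5 + (xi - lam) * (f * Real.logb 3 2) - t * (1 + xi)) :
    ∀ᶠ n : ℕ in atTop, t * n ≤ logCount (targetDigits d lam xi) n := by
  have hτ := logb_three_two_pos
  have hxi : 0 < xi := hlam.trans_le hle
  have hts : t ≤ Real.logb 3 5 := by nlinarith
  obtain ⟨ε, hε, hεη⟩ : ∃ ε > 0, Real.logb 3 2 * ε * (lam + xi) = η / 2 :=
    ⟨η / 2 / (Real.logb 3 2 * (lam + xi)), by positivity, by field_simp⟩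
  obtain ⟨K, hK⟩ := hf ε hε
  obtain ⟨k₀, hk₀⟩ := eventually_atTop.1
    ((eventually_logCount_blockStart_ge (d := d) hle hxi.le (half_pos hη)).and
      ((tendsto_blockStart.eventually_ge_atTop (t / η)).and
      (tendsto_blockStart.eventually_ge_atTop
        ((t + f * Real.logb 3 2 + 2 * Real.logb 3 2 * ε + 2 * K * Real.logb 3 2) / η))))
  filter_upwards [eventually_ge_atTop (blockStart k₀)] with n hn
  obtain ⟨k, hk, hkn, hnk⟩ := exists_block hn
  obtain ⟨hL, hb, hb'⟩ := hk₀ k hk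
  rw [div_le_iff₀ hη] at hb hb'
  obtain ⟨j, rfl⟩ := Nat.exists_eq_add_of_le hkn
  have hb0 : (0 : ℝ) ≤ blockStart k := Nat.cast_nonneg _
  obtain ⟨m, hm⟩ : ∃ m, m = ⌈lam * blockStart k⌉₊ := ⟨_, rfl⟩
  obtain ⟨M, hM⟩ : ∃ M, M = ⌈xi * blockStart k⌉₊ := ⟨_, rfl⟩
  have hmM : m ≤ M := by rw [hm, hM]; exact Nat.ceil_mono (by gcongr)
  have hm1 : lam * blockStart k ≤ m := by rw [hm]; exact Nat.le_ceil _
  have hm2 : (m : ℝ) ≤ lam * blockStart k + 1 := by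
    rw [hm]; exact (Nat.ceil_lt_add_one (by positivity)).le
  have hM2 : (M : ℝ) ≤ xi * blockStart k + 1 := by
    rw [hM]; exact (Nat.ceil_lt_add_one (by positivity)).le
  have hmid : ∀ i, m + i ≤ M → blockStart k + (m + i) < blockStart (k + 1) →
      t * ((blockStart k + (m + i) : ℕ) : ℝ) ≤
        logCount (targetDigits d lam xi) (blockStart k + (m + i)) := by
    intro i hi hik
    have hiM : ((m + i : ℕ) : ℝ) ≤ xi * blockStart k + 1 := (Nat.cast_le.2 hi).trans hM2
    have hmi : (m : ℝ) ≤ (m + i : ℕ) := by exact_mod_cast Nat.le_add_right m i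
    have h3 := logCount_row hd hm (hM ▸ hi) hik
    have h4 := logCount_mono (targetDigits d lam xi) (Nat.le_add_right (blockStart k) m)
    have h5 := linear_interpolation_ge h1 h2 (by positivity) ht hb0 (hm1.trans hmi) hiM
    have h6 : f * (m + i : ℕ) - ε * (xi * blockStart k + 1) - K ≤
        nonOnes (fun i => (d i).2) (m + i) := by
      linarith [(abs_le.1 (hK (m + i))).1, mul_le_mul_of_nonneg_left hiM hε.le]
    have h7 : (nonOnes (fun i => (d i).2) m : ℝ) ≤
        f * (lam * blockStart k + 1) + ε * (lam * blockStart k + 1) + K := by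
      linarith [(abs_le.1 (hK m)).2, mul_le_mul_of_nonneg_left hm2 hε.le,
        mul_le_mul_of_nonneg_left hm2 hf0]
    have h8 := mul_le_mul_of_nonneg_right (sub_le_sub h6 h7) hτ.le
    have h9 := congrArg (fun x => x * (blockStart k : ℝ)) hεη
    push_cast at *
    linarith
  rcases le_or_gt j m with hj | hj
  · have h3 := logCount_mono (targetDigits d lam xi) (Nat.le_add_right (blockStart k) j)
    have h4 : (j : ℝ) ≤ lam * blockStart k + 1 := (Nat.cast_le.2 hj).trans hm2
    have h5 := mul_le_mul_of_nonneg_right h1 hb0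
    have h6 := mul_le_mul_of_nonneg_left h4 ht
    have h7 := mul_nonneg hη.le hb0
    push_cast
    linarith
  obtain ⟨i, rfl⟩ := Nat.exists_eq_add_of_le hj.le
  rcases le_or_gt (m + i) M with hi | hi
  · exact hmid i hi hnk
  · obtain ⟨r, hr⟩ := Nat.exists_eq_add_of_le hi.le
    obtain ⟨i', hi'⟩ := Nat.exists_eq_add_of_le hmM
    have h3 := hmid i' (by omega) (by omega)
    rw [hr] at hnk ⊢
    rw [← hi'] at h3
    have h4 := logCount_full (d := d) hle hM hnk
    have h5 := mul_le_mul_of_nonneg_right hts (Nat.cast_nonneg (α := ℝ) r)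
    push_cast at *
    linarith

theorem le_dimH_targetSet (hlam : 0 < lam) (hle : lam ≤ xi)
    (hd : ∀ i, d i ∈ vDigits) (hf0 : 0 ≤ f)
    (hf : ∀ ε > 0, ∃ K : ℝ, ∀ n : ℕ,
      |(nonOnes (fun i => (d i).2) n : ℝ) - f * n| ≤ ε * n + K) :
    ENNReal.ofReal (min (Real.logb 3 5 / (1 + lam))
      ((Real.logb 3 5 + (xi - lam) * (f * Real.logb 3 2)) / (1 + xi))) ≤
      dimH (targetSet lam xi (val3 fun i => (d i).1) (val3 fun i => (d i).2)) := by
  refine le_of_forall_lt_imp_le_of_dense fun b hb => ?_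
  obtain ⟨t, ht0, htb, ht⟩ := ENNReal.lt_iff_exists_real_btwn.1 hb
  refine htb.le.trans (le_trans ?_ (dimH_mono (digitSet_targetDigits_subset hle hd)))
  obtain ⟨h1, h2⟩ := lt_min_iff.1 (ENNReal.ofReal_lt_ofReal_iff'.1 ht).1
  rw [lt_div_iff₀ (by linarith)] at h1 h2
  refine le_dimH_digitSet_of_logCount (targetDigits_nonempty hd) (targetDigits_subset hd)
    (eventually_le_logCount_targetDigits hlam hle hd hf0 hf ht0
      (η := min (Real.logb 3 5 - t * (1 + lam))
        (Real.logb 3 5 + (xi - lam) * (f * Real.logb 3 2) - t * (1 + xi)) / 2)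
      (half_pos (lt_min (by linarith) (by linarith))) ?_ ?_)
  · rw [mul_div_cancel₀ _ two_ne_zero]; exact min_le_left _ _
  · rw [mul_div_cancel₀ _ two_ne_zero]; exact min_le_right _ _

end LowerBounds

lemma dimH_horizontal_slice (y₂ : ℝ) :
    dimH {t ∈ Icc (0 : ℝ) 1 | (t, y₂) ∈ V} = dimH {p : ℝ × ℝ | p ∈ V ∧ p.2 = y₂} := by
  have hiso : Isometry fun t : ℝ => (t, y₂) := Isometry.of_dist_eq fun a b => by
    simp [Prod.dist_eq]
  rw [← hiso.dimH_image]
  congr 1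
  ext ⟨a, b⟩
  simp only [mem_image, mem_ofPred_eq, Prod.mk.injEq]
  constructor
  · rintro ⟨t, ⟨-, ht⟩, rfl, rfl⟩
    exact ⟨ht, rfl⟩
  · rintro ⟨hV, rfl⟩
    obtain ⟨d, hd, hp⟩ := hV
    obtain ⟨rfl, -⟩ := Prod.mk.inj hp
    exact ⟨_, ⟨⟨val3_nonneg _, val3_le_one fun i hi => (lt_three_of_mem_vDigits (hd i hi)).1⟩,
      d, hd, hp⟩, rfl, rfl⟩


theorem stmt_0 (lam xi : ℝ) (hlam : 0 < lam) (hle : lam ≤ xi)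
    (y₁ y₂ : ℝ) (hy : (y₁, y₂) ∈ V)
    (w : ℕ → ℕ) (hw : ∀ i, 1 ≤ i → w i < 3)
    (hrep : y₂ = val3 w)
    (hfreq : ∀ a, a < 3 → ∃ fa : ℝ,
      Tendsto (fun n : ℕ => (((Finset.Icc 1 n).filter fun i => w i = a).card : ℝ) / n)
        atTop (𝓝 fa)) :
    dimH {p | p ∈ V ∧ ∃ᶠ n : ℕ in atTop,
        (Ttilde^[n] p).1 ∈
          Icc (y₁ - (3 : ℝ) ^ (-(n : ℝ) * lam)) (y₁ + (3 : ℝ) ^ (-(n : ℝ) * lam)) ∧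
        (Ttilde^[n] p).2 ∈
          Icc (y₂ - (3 : ℝ) ^ (-(n : ℝ) * xi)) (y₂ + (3 : ℝ) ^ (-(n : ℝ) * xi))} =
      min (dimH V / ENNReal.ofReal (1 + lam))
        ((dimH V + ENNReal.ofReal (xi - lam) * dimH {t ∈ Icc (0 : ℝ) 1 | (t, y₂) ∈ V}) /
          ENNReal.ofReal (1 + xi)) := by
  obtain ⟨f₁, hf₁⟩ := hfreq 1 (by norm_num)
  obtain ⟨f, hf0, hf⟩ := exists_freq_nonOnes hf₁
  obtain ⟨d, hd, hyd⟩ := exists_digits_of_mem_V hy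
  obtain ⟨hy₁, hy₂⟩ := Prod.mk.inj hyd
  have hd2 : ∀ i, 1 ≤ i → (d i).2 < 3 := fun i _ => (lt_three_of_mem_vDigits (hd i)).2
  have hfd : ∀ ε > 0, ∃ K : ℝ, ∀ n : ℕ,
      |(nonOnes (fun i => (d i).2) n : ℝ) - f * n| ≤ ε * n + K := by
    intro ε hε
    obtain ⟨K, hK⟩ := hf ε hε
    refine ⟨K + 1, fun n => ?_⟩
    have h1 : (nonOnes w n : ℝ) ≤ nonOnes (fun i => (d i).2) n + 1 := by
      exact_mod_cast nonOnes_le_add_one hw hd2 (hrep.symm.trans hy₂) n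
    have h2 : (nonOnes (fun i => (d i).2) n : ℝ) ≤ nonOnes w n + 1 := by
      exact_mod_cast nonOnes_le_add_one hd2 hw (hy₂.symm.trans hrep) n
    have h3 := abs_le.1 (hK n)
    exact abs_le.2 ⟨by linarith [h3.1], by linarith [h3.2]⟩
  have hs := logb_three_five_pos
  have hfτ : 0 ≤ f * Real.logb 3 2 := mul_nonneg hf0 logb_three_two_pos.le
  have hV : dimH V = ENNReal.ofReal (Real.logb 3 5) := le_antisymm dimH_V_le le_dimH_V
  have hslice : dimH {t ∈ Icc (0 : ℝ) 1 | (t, y₂) ∈ V} =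
      ENNReal.ofReal (f * Real.logb 3 2) := by
    rw [dimH_horizontal_slice]
    refine le_antisymm (dimH_slice_le hw hrep hf hf0) ?_
    rw [hy₂]
    exact le_dimH_slice hd hfd
  rw [hV, hslice, ← ENNReal.ofReal_mul (sub_nonneg.2 hle),
    ← ENNReal.ofReal_add hs.le (mul_nonneg (sub_nonneg.2 hle) hfτ),
    ← ENNReal.ofReal_div_of_pos (by linarith), ← ENNReal.ofReal_div_of_pos (by linarith)]
  refine le_antisymm (le_min (dimH_targetSet_le_left hlam hle)
    (dimH_targetSet_le_right hlam hle hy hw hrep hf hf0)) ?_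
  rw [← ENNReal.ofReal_min, hy₁, hy₂]
  exact le_dimH_targetSet hlam hle hd hf0 hfd

end Vicsek
end
end

section
/- Fix (z,w) ∈ Λ with z ∉ {0,1} and w ∉ {0,1}. Then Λ_{λ,ξ}(z,w) = W_{λ,ξ}(z,w). -/
open Set Filter Topology MeasureTheory
open scoped ENNReal NNReal Topology

noncomputable section

namespace ShrinkingRect

/-- The real number with 1-indexed base-`b` digit sequence `u` (digit `i` is `u i` for `i ≥ 1`). -/
def val (b : ℕ) (u : ℕ → ℕ) : ℝ := ∑' i : ℕ, (u (i + 1) : ℝ) / (b : ℝ) ^ (i + 1)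

/-- The self-similar carpet `Λ` with digit set `J ⊆ {0,…,b−1}²`. -/
def carpet (b : ℕ) (J : Finset (ℕ × ℕ)) : Set (ℝ × ℝ) :=
  {p | ∃ d : ℕ → ℕ × ℕ, (∀ i, 1 ≤ i → d i ∈ J) ∧
    p = (val b (fun i => (d i).1), val b (fun i => (d i).2))}

/-- `J₂(a)`: the digits of `J` lying in row `a`. -/
def J2 (J : Finset (ℕ × ℕ)) (a : ℕ) : Finset (ℕ × ℕ) := J.filter fun p => p.2 = a

/-- The contraction `f_{u,v}(x,y) = ((x+u)/b, (y+v)/b)`. -/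
def fmap (b : ℕ) (uv : ℕ × ℕ) (p : ℝ × ℝ) : ℝ × ℝ :=
  ((p.1 + (uv.1 : ℝ)) / b, (p.2 + (uv.2 : ℝ)) / b)

/-- `f_t = f_{u₁,v₁} ∘ ⋯ ∘ f_{uₙ,vₙ}` for a finite word `t = ((u₁,v₁),…,(uₙ,vₙ))`. -/
def fword (b : ℕ) (t : List (ℕ × ℕ)) (p : ℝ × ℝ) : ℝ × ℝ :=
  t.foldr (fmap b) p

/-- The limsup set `W_{λ,ξ}(z,w)`. -/
def Wset (b : ℕ) (J : Finset (ℕ × ℕ)) (lam xi : ℕ → ℕ) (z w : ℝ) : Set (ℝ × ℝ) :=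
  {p | p ∈ carpet b J ∧
    {t : List (ℕ × ℕ) | t ≠ [] ∧ (∀ e ∈ t, e ∈ J) ∧
      |p.1 - (fword b t (z, w)).1| ≤ (b : ℝ) ^ (-(lam t.length : ℤ) - (t.length : ℤ)) ∧
      |p.2 - (fword b t (z, w)).2| ≤ (b : ℝ) ^ (-(xi t.length : ℤ) - (t.length : ℤ))}.Infinite}

/-- The closeness condition (in one coordinate) defining `M_n(z,w)`:
`xd` is the digit string of the point, `zd` that of the centre, `L` is `λ(n)` or `ξ(n)`. -/
def closeCond (b L n : ℕ) (zd xd : ℕ → ℕ) : Prop :=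
  (∀ i, 1 ≤ i → i < L → xd (i + n) = zd i) ∨
  (∃ j, 1 ≤ j ∧ j < L ∧ (∀ i, 1 ≤ i → i ≤ j - 1 → xd (i + n) = zd i) ∧
    (((xd (j + n) : ℤ) - (zd j : ℤ) = -1 ∧
        ∀ i, j + 1 ≤ i → i < L → (xd (i + n) : ℤ) - (zd i : ℤ) = (b : ℤ) - 1) ∨
     ((xd (j + n) : ℤ) - (zd j : ℤ) = 1 ∧
        ∀ i, j + 1 ≤ i → i < L → (zd i : ℤ) - (xd (i + n) : ℤ) = (b : ℤ) - 1)))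

/-- A choice of representative digit sequences for the points of the carpet: each point of `Λ`
gets a digit sequence in `J` representing it, whose partial products of row cardinalities
`∏ #J₂(y_i)` are eventually maximal among all representations of that point. -/
structure RepMap (b : ℕ) (J : Finset (ℕ × ℕ)) where
  rep : ℝ × ℝ → ℕ → ℕ × ℕ
  mem_J : ∀ p ∈ carpet b J, ∀ i, 1 ≤ i → rep p i ∈ J
  eq_val : ∀ p ∈ carpet b J,
    p = (val b (fun i => (rep p i).1), val b (fun i => (rep p i).2))
  maximal : ∀ p ∈ carpet b J, ∀ d : ℕ → ℕ × ℕ, (∀ i, 1 ≤ i → d i ∈ J) →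
    p = (val b (fun i => (d i).1), val b (fun i => (d i).2)) →
    ∃ N₀ : ℕ, ∀ N, N₀ ≤ N →
      ∏ i ∈ Finset.Icc 1 N, (J2 J (d i).2).card ≤
        ∏ i ∈ Finset.Icc 1 N, (J2 J (rep p i).2).card

/-- The expanding map `T(x,y) = (bx − x₁, by − y₁)`, where `(x_i,y_i)` is the representative
digit sequence of `(x,y)`. -/
def Tmap {b : ℕ} {J : Finset (ℕ × ℕ)} (R : RepMap b J) (p : ℝ × ℝ) : ℝ × ℝ :=
  ((b : ℝ) * p.1 - ((R.rep p 1).1 : ℝ), (b : ℝ) * p.2 - ((R.rep p 1).2 : ℝ))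

/-- The shrinking target set `Λ_{λ,ξ}(z,w)`. -/
def targetSet {b : ℕ} {J : Finset (ℕ × ℕ)} (R : RepMap b J) (lam xi : ℕ → ℕ)
    (z w : ℝ) : Set (ℝ × ℝ) :=
  {p | p ∈ carpet b J ∧ ∃ᶠ n in atTop,
    ((Tmap R)^[n] p).1 ∈ Icc (z - (b : ℝ) ^ (-(lam n : ℤ))) (z + (b : ℝ) ^ (-(lam n : ℤ))) ∧
    ((Tmap R)^[n] p).2 ∈ Icc (w - (b : ℝ) ^ (-(xi n : ℤ))) (w + (b : ℝ) ^ (-(xi n : ℤ)))}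

/-- The set `M_n(z,w)` (as a set of points of `Λ`, via representative sequences). -/
def Mset {b : ℕ} {J : Finset (ℕ × ℕ)} (R : RepMap b J) (lam xi : ℕ → ℕ)
    (zw : ℝ × ℝ) (n : ℕ) : Set (ℝ × ℝ) :=
  {p | p ∈ carpet b J ∧
    closeCond b (lam n) n (fun i => (R.rep zw i).1) (fun i => (R.rep p i).1) ∧
    closeCond b (xi n) n (fun i => (R.rep zw i).2) (fun i => (R.rep p i).2)}

/-- `p_{n,j}(a,y) = #{λ(n) ≤ i ≤ j : y_{i+n} = a}`. -/
def pcount {b : ℕ} {J : Finset (ℕ × ℕ)} (R : RepMap b J) (lam : ℕ → ℕ)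
    (p : ℝ × ℝ) (a n j : ℕ) : ℕ :=
  ((Finset.Icc (lam n) j).filter fun i => (R.rep p (i + n)).2 = a).card

/-- `A_{n,j}(z,w) = max_{(x,y) ∈ M_n(z,w)} Σ_a p_{n,j}(a,y) log #J₂(a)`. -/
def Aval {b : ℕ} {J : Finset (ℕ × ℕ)} (R : RepMap b J) (lam xi : ℕ → ℕ)
    (zw : ℝ × ℝ) (n j : ℕ) : ℝ :=
  sSup ((fun p => ∑ a ∈ Finset.range b,
    (pcount R lam p a n j : ℝ) * Real.log ((J2 J a).card)) '' Mset R lam xi zw n)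

/-- `s_n = min{ (n log #J + A_{n,j}(z,w)) / ((n+j) log b) : λ(n) ≤ j ≤ ξ(n) }`. -/
def sval {b : ℕ} {J : Finset (ℕ × ℕ)} (R : RepMap b J) (lam xi : ℕ → ℕ)
    (zw : ℝ × ℝ) (n : ℕ) : ℝ :=
  sInf ((fun j : ℕ => ((n : ℝ) * Real.log J.card + Aval R lam xi zw n j) /
    (((n : ℝ) + (j : ℝ)) * Real.log b)) '' Set.Icc (lam n) (xi n))

/-- `#{1 ≤ i ≤ n : u i = a}`. -/
def freqCount (u : ℕ → ℕ) (a n : ℕ) : ℕ := ((Finset.Icc 1 n).filter fun i => u i = a).card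

/-- The second-coordinate digit string of the representative sequence of a point. -/
def wdig {b : ℕ} {J : Finset (ℕ × ℕ)} (R : RepMap b J) (zw : ℝ × ℝ) (i : ℕ) : ℕ :=
  (R.rep zw i).2

theorem summable_digits {b : ℕ} (hb : 2 ≤ b) {u : ℕ → ℕ} (hu : ∀ i, 1 ≤ i → u i < b) :
    Summable fun i : ℕ => (u (i + 1) : ℝ) / (b : ℝ) ^ (i + 1) := by
  have hb1 : (1 : ℝ) < b := by exact_mod_cast hb
  have hg : Summable fun i : ℕ => ((b : ℝ)⁻¹) ^ i :=
    summable_geometric_of_lt_one (by positivity) (inv_lt_one_of_one_lt₀ hb1)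
  refine Summable.of_nonneg_of_le (fun i => by positivity) (fun i => ?_) hg
  have h : (u (i + 1) : ℝ) ≤ b := by exact_mod_cast (hu (i + 1) (by omega)).le
  rw [inv_pow, pow_succ, div_le_iff₀ (by positivity)]
  field_simp
  exact h

theorem val_nonneg (b : ℕ) (u : ℕ → ℕ) : 0 ≤ val b u :=
  tsum_nonneg fun i => by positivity

theorem val_le_one {b : ℕ} (hb : 2 ≤ b) {u : ℕ → ℕ} (hu : ∀ i, 1 ≤ i → u i < b) :
    val b u ≤ 1 := by
  have hb1 : (1 : ℝ) < b := by exact_mod_cast hb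
  have hg := (hasSum_geometric_of_lt_one (r := (b : ℝ)⁻¹) (by positivity)
    (inv_lt_one_of_one_lt₀ hb1)).mul_left (((b : ℝ) - 1) / b)
  have h1 : ((b : ℝ) - 1) / b * (1 - (b : ℝ)⁻¹)⁻¹ = 1 := by
    have : (b : ℝ) - 1 ≠ 0 := by linarith
    have : (b : ℝ) ≠ 0 := by linarith
    field_simp
  rw [h1] at hg
  refine hasSum_le (fun i => ?_) (summable_digits hb hu).hasSum hg
  have h : (u (i + 1) : ℝ) ≤ b - 1 := by
    have : (u (i + 1) : ℝ) + 1 ≤ b := by exact_mod_cast hu (i + 1) (by omega)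
    linarith
  rw [inv_pow, ← div_eq_mul_inv, div_div, ← pow_succ']
  gcongr

theorem val_eq_head_add_tail {b : ℕ} (hb : 2 ≤ b) {u : ℕ → ℕ} (hu : ∀ i, 1 ≤ i → u i < b) :
    (b : ℝ) * val b u = u 1 + val b fun i => u (i + 1) := by
  have hb0 : (b : ℝ) ≠ 0 := by positivity
  rw [val, (summable_digits hb hu).tsum_eq_zero_add, mul_add, ← tsum_mul_left, val]
  congr 1
  · simp [mul_div_cancel₀ _ hb0]
  · refine tsum_congr fun i => ?_
    rw [pow_succ' _ (i + 1), mul_div_assoc', mul_div_mul_left _ _ hb0]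

theorem digit_lt {b : ℕ} {J : Finset (ℕ × ℕ)} (hJ : J ⊆ Finset.range b ×ˢ Finset.range b)
    {e : ℕ × ℕ} (he : e ∈ J) : e.1 < b ∧ e.2 < b := by
  simpa using hJ he

theorem carpet_subset_Icc {b : ℕ} {J : Finset (ℕ × ℕ)} (hb : 2 ≤ b)
    (hJ : J ⊆ Finset.range b ×ˢ Finset.range b) {p : ℝ × ℝ} (hp : p ∈ carpet b J) :
    p.1 ∈ Icc (0 : ℝ) 1 ∧ p.2 ∈ Icc (0 : ℝ) 1 := by
  obtain ⟨d, hd, rfl⟩ := hp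
  exact ⟨⟨val_nonneg b fun i => (d i).1, val_le_one hb fun i hi => (digit_lt hJ (hd i hi)).1⟩,
    val_nonneg b fun i => (d i).2, val_le_one hb fun i hi => (digit_lt hJ (hd i hi)).2⟩

theorem Tmap_mem_carpet {b : ℕ} {J : Finset (ℕ × ℕ)} (hb : 2 ≤ b)
    (hJ : J ⊆ Finset.range b ×ˢ Finset.range b) (R : RepMap b J) {p : ℝ × ℝ}
    (hp : p ∈ carpet b J) : Tmap R p ∈ carpet b J := by
  refine ⟨fun i => R.rep p (i + 1), fun i _ => R.mem_J p hp _ (by omega), ?_⟩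
  have hfst : p.1 = val b fun i => (R.rep p i).1 := congrArg Prod.fst (R.eq_val p hp)
  have hsnd : p.2 = val b fun i => (R.rep p i).2 := congrArg Prod.snd (R.eq_val p hp)
  have h1 := val_eq_head_add_tail hb fun i hi => (digit_lt hJ (R.mem_J p hp i hi)).1
  have h2 := val_eq_head_add_tail hb fun i hi => (digit_lt hJ (R.mem_J p hp i hi)).2
  rw [← hfst] at h1
  rw [← hsnd] at h2
  ext
  · simp only [Tmap]; linarith
  · simp only [Tmap]; linarith

theorem fmap_Tmap {b : ℕ} {J : Finset (ℕ × ℕ)} (hb : 2 ≤ b) (R : RepMap b J) (p : ℝ × ℝ) :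
    fmap b (R.rep p 1) (Tmap R p) = p := by
  have hb0 : (b : ℝ) ≠ 0 := by positivity
  ext <;> simp [fmap, Tmap, hb0]

theorem fmap_mem_Ioo {b : ℕ} {e : ℕ × ℕ} (he : e.1 < b ∧ e.2 < b) {q : ℝ × ℝ}
    (hq : q.1 ∈ Ioo (0 : ℝ) 1 ∧ q.2 ∈ Ioo (0 : ℝ) 1) :
    (fmap b e q).1 ∈ Ioo (0 : ℝ) 1 ∧ (fmap b e q).2 ∈ Ioo (0 : ℝ) 1 := by
  obtain ⟨⟨h1, h2⟩, h3, h4⟩ := hq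
  have hb0 : (0 : ℝ) < b := by exact_mod_cast (Nat.zero_le _).trans_lt he.1
  have e1 : (e.1 : ℝ) + 1 ≤ b := by exact_mod_cast he.1
  have e2 : (e.2 : ℝ) + 1 ≤ b := by exact_mod_cast he.2
  refine ⟨⟨?_, ?_⟩, ?_, ?_⟩ <;> simp only [fmap]
  · positivity
  · rw [div_lt_one hb0]; linarith
  · positivity
  · rw [div_lt_one hb0]; linarith

theorem fword_mem_Ioo {b : ℕ} {t : List (ℕ × ℕ)} (ht : ∀ e ∈ t, e.1 < b ∧ e.2 < b) {q : ℝ × ℝ}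
    (hq : q.1 ∈ Ioo (0 : ℝ) 1 ∧ q.2 ∈ Ioo (0 : ℝ) 1) :
    (fword b t q).1 ∈ Ioo (0 : ℝ) 1 ∧ (fword b t q).2 ∈ Ioo (0 : ℝ) 1 := by
  induction t with
  | nil => exact hq
  | cons e t ih =>
    rw [List.forall_mem_cons] at ht
    exact fmap_mem_Ioo ht.1 (ih ht.2)

theorem fword_sub_fword {b : ℕ} (hb : 2 ≤ b) (t : List (ℕ × ℕ)) (q r : ℝ × ℝ) :
    (fword b t q).1 - (fword b t r).1 = (q.1 - r.1) * (b : ℝ) ^ (-(t.length : ℤ)) ∧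
      (fword b t q).2 - (fword b t r).2 = (q.2 - r.2) * (b : ℝ) ^ (-(t.length : ℤ)) := by
  have hb0 : (b : ℝ) ≠ 0 := by positivity
  induction t with
  | nil => simp [fword]
  | cons e t ih =>
    have h : (b : ℝ) ^ (-((e :: t).length : ℤ)) = (b : ℝ) ^ (-(t.length : ℤ)) / b := by
      rw [List.length_cons, Nat.cast_succ, neg_add, zpow_add₀ hb0, zpow_neg_one, div_eq_mul_inv]
    rw [h, mul_div_assoc', mul_div_assoc', ← ih.1, ← ih.2]
    simp only [fword, List.foldr_cons, fmap]
    constructor <;> ring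

theorem exists_fword_iterate_Tmap {b : ℕ} {J : Finset (ℕ × ℕ)} (hb : 2 ≤ b)
    (hJ : J ⊆ Finset.range b ×ˢ Finset.range b) (R : RepMap b J) (n : ℕ) {p : ℝ × ℝ}
    (hp : p ∈ carpet b J) :
    ∃ t : List (ℕ × ℕ), t.length = n ∧ (∀ e ∈ t, e ∈ J) ∧ fword b t ((Tmap R)^[n] p) = p := by
  induction n generalizing p with
  | zero => exact ⟨[], by simp [fword]⟩
  | succ n ih =>
    obtain ⟨t, hlen, ht, hft⟩ := ih (Tmap_mem_carpet hb hJ R hp)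
    refine ⟨R.rep p 1 :: t, by simp [hlen], ?_, ?_⟩
    · rw [List.forall_mem_cons]
      exact ⟨R.mem_J p hp 1 le_rfl, ht⟩
    · rw [Function.iterate_succ_apply]
      exact (congrArg (fmap b (R.rep p 1)) hft).trans (fmap_Tmap hb R p)

theorem natCast_add_cancel {m k : ℕ} {x y : ℝ} (hx : x ∈ Ioo (0 : ℝ) 1) (hy : y ∈ Icc (0 : ℝ) 1)
    (h : y + k = x + m) : y = x := by
  obtain ⟨h1, h2⟩ := hx
  obtain ⟨h3, h4⟩ := hy
  have a : k < m + 1 := by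
    have : (k : ℝ) < m + 1 := by linarith
    exact_mod_cast this
  have c : m < k + 1 := by
    have : (m : ℝ) < k + 1 := by linarith
    exact_mod_cast this
  obtain rfl : k = m := by omega
  linarith

/-- A word whose open cylinder contains a point of the carpet gives the orbit of that point. -/
theorem iterate_Tmap_fword {b : ℕ} {J : Finset (ℕ × ℕ)} (hb : 2 ≤ b)
    (hJ : J ⊆ Finset.range b ×ˢ Finset.range b) (R : RepMap b J) {t : List (ℕ × ℕ)}
    (ht : ∀ e ∈ t, e.1 < b ∧ e.2 < b) {q : ℝ × ℝ}
    (hq : q.1 ∈ Ioo (0 : ℝ) 1 ∧ q.2 ∈ Ioo (0 : ℝ) 1) (hp : fword b t q ∈ carpet b J) :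
    (Tmap R)^[t.length] (fword b t q) = q := by
  have hb0 : (b : ℝ) ≠ 0 := by positivity
  induction t with
  | nil => rfl
  | cons e t ih =>
    rw [List.forall_mem_cons] at ht
    have hT := Tmap_mem_carpet hb hJ R hp
    have hI := carpet_subset_Icc hb hJ hT
    have hO := fword_mem_Ioo ht.2 hq
    have hf : fmap b _ (Tmap R (fword b (e :: t) q)) = fmap b e (fword b t q) := fmap_Tmap hb R _
    have key : Tmap R (fword b (e :: t) q) = fword b t q := by
      simp only [fmap, Prod.mk.injEq, div_left_inj' hb0] at hf
      exact Prod.ext (natCast_add_cancel hO.1 hI.1 hf.1) (natCast_add_cancel hO.2 hI.2 hf.2)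
    rw [List.length_cons, Function.iterate_succ_apply, key]
    exact ih ht.2 (key ▸ hT)

theorem finite_words_length_le {α : Type*} (J : Finset α) (N : ℕ) :
    {t : List α | t.length ≤ N ∧ ∀ e ∈ t, e ∈ J}.Finite := by
  refine ((List.finite_length_le J N).image (List.map Subtype.val)).subset ?_
  rintro t ⟨hN, ht⟩
  exact ⟨t.attachWith (· ∈ J) ht, by simpa using hN, by simp⟩

theorem eventually_zpow_neg_lt {b : ℕ} (hb : 2 ≤ b) {l : ℕ → ℕ} (hl : Tendsto l atTop atTop)
    {ε : ℝ} (hε : 0 < ε) : ∀ᶠ n in atTop, (b : ℝ) ^ (-(l n : ℤ)) < ε := by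
  have hb1 : (1 : ℝ) < b := by exact_mod_cast hb
  have h := (tendsto_pow_atTop_nhds_zero_of_lt_one (r := (b : ℝ)⁻¹) (by positivity)
    (inv_lt_one_of_one_lt₀ hb1)).comp hl
  filter_upwards [h.eventually_lt_const hε] with n hn
  simpa using hn

/-- A closed neighbourhood of an interior point of `[0,1]` of small radius stays in `(0,1)`. -/
theorem exists_radius_Ioo {x : ℝ} (hx : x ∈ Icc (0 : ℝ) 1) (h0 : x ≠ 0) (h1 : x ≠ 1) :
    ∃ ε > 0, ∀ y, |y - x| < ε → y ∈ Ioo (0 : ℝ) 1 :=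
  Metric.isOpen_iff.1 isOpen_Ioo x ⟨lt_of_le_of_ne hx.1 h0.symm, lt_of_le_of_ne hx.2 h1⟩

theorem stmt_1
    (b : ℕ) (J : Finset (ℕ × ℕ)) (hb : 2 ≤ b)
    (hJ : J ⊂ Finset.range b ×ˢ Finset.range b) (hJcard : 2 ≤ J.card)
    (R : RepMap b J) (lam xi : ℕ → ℕ)
    (hlam_pos : ∀ n, 1 ≤ lam n) (hle : ∀ n, lam n ≤ xi n)
    (hlam_top : Tendsto lam atTop atTop)
    (z w : ℝ) (hzw : (z, w) ∈ carpet b J)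
    (hz0 : z ≠ 0) (hz1 : z ≠ 1) (hw0 : w ≠ 0) (hw1 : w ≠ 1) :
    targetSet R lam xi z w = Wset b J lam xi z w := by
  have hJ' := hJ.1
  have hb0 : (b : ℝ) ≠ 0 := by positivity
  have hdist (t : List (ℕ × ℕ)) (q : ℝ × ℝ) (L M : ℕ) :
      (|(fword b t q).1 - (fword b t (z, w)).1| ≤ (b : ℝ) ^ (-(L : ℤ) - (t.length : ℤ)) ∧
        |(fword b t q).2 - (fword b t (z, w)).2| ≤ (b : ℝ) ^ (-(M : ℤ) - (t.length : ℤ))) ↔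
      |q.1 - z| ≤ (b : ℝ) ^ (-(L : ℤ)) ∧ |q.2 - w| ≤ (b : ℝ) ^ (-(M : ℤ)) := by
    have hpos : (0 : ℝ) < (b : ℝ) ^ (-(t.length : ℤ)) := by positivity
    rw [(fword_sub_fword hb t q (z, w)).1, (fword_sub_fword hb t q (z, w)).2,
      sub_eq_add_neg (-(L : ℤ)), sub_eq_add_neg (-(M : ℤ)), zpow_add₀ hb0, zpow_add₀ hb0, abs_mul, abs_mul, abs_of_pos hpos,
      mul_le_mul_iff_left₀ hpos, mul_le_mul_iff_left₀ hpos]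
  ext p
  simp only [targetSet, Wset, mem_ofPred_eq, ← Real.closedBall_eq_Icc, mem_closedBall_iff_norm,
    Real.norm_eq_abs]
  refine and_congr_right fun hp => ⟨fun hfreq => ?_, fun hinf => ?_⟩
  · intro hfin
    obtain ⟨N, hN⟩ := (hfin.image List.length).bddAbove
    obtain ⟨n, hn, hclose⟩ := frequently_atTop.1 hfreq (N + 1)
    obtain ⟨t, rfl, ht, hft⟩ := exists_fword_iterate_Tmap hb hJ' R n hp
    have hmem := (hdist t _ _ _).2 hclose
    rw [hft] at hmem
    have := hN ⟨t, ⟨by rintro rfl; simp at hn, ht, hmem⟩, rfl⟩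
    omega
  · obtain ⟨hz, hw⟩ := carpet_subset_Icc hb hJ' hzw
    obtain ⟨ε, hε, hzε⟩ := exists_radius_Ioo hz hz0 hz1
    obtain ⟨δ, hδ, hwδ⟩ := exists_radius_Ioo hw hw0 hw1
    obtain ⟨N, hN⟩ := eventually_atTop.1 ((eventually_zpow_neg_lt hb hlam_top hε).and
      (eventually_zpow_neg_lt hb (tendsto_atTop_mono hle hlam_top) hδ))
    refine frequently_atTop.2 fun m => ?_
    obtain ⟨t, ⟨-, ht, hclose⟩, hlen⟩ :=
      (hinf.sdiff (finite_words_length_le J (max N m))).nonempty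
    have hlen : max N m < t.length := by
      by_contra h
      exact hlen ⟨not_lt.1 h, ht⟩
    set q : ℝ × ℝ := (z + (p.1 - (fword b t (z, w)).1) * (b : ℝ) ^ (t.length : ℤ),
      w + (p.2 - (fword b t (z, w)).2) * (b : ℝ) ^ (t.length : ℤ)) with hq
    have hpq : fword b t q = p := by
      have h := fword_sub_fword hb t q (z, w)
      simp only [hq, add_sub_cancel_left, mul_assoc, ← zpow_add₀ hb0, add_neg_cancel, zpow_zero,
        mul_one, sub_left_inj] at h
      exact Prod.ext h.1 h.2
    rw [← hpq, hdist] at hclose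
    obtain ⟨h1, h2⟩ := hN t.length ((le_max_left _ _).trans hlen.le)
    have hT := iterate_Tmap_fword hb hJ' R (fun e he => digit_lt hJ' (ht e he))
      ⟨hzε _ (hclose.1.trans_lt h1), hwδ _ (hclose.2.trans_lt h2)⟩ (hpq.symm ▸ hp)
    rw [hpq] at hT
    exact ⟨t.length, (le_max_right _ _).trans hlen.le, by rw [hT]; exact hclose⟩

end ShrinkingRect
end
end
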